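/- Let 𝒩₃(N) denote the number of subsets S of {1,…,N³} with |S| = N and Σ_{i∈S} i = N(N³+1)/2. Then, as N → ∞, 𝒩₃(N) = (√3/π) · (N²·e)^N / N⁴ · (1 − 11/(15N) + 157/(126N²) + O(1/N³)); equivalently, (π/√3)·N⁴·(N²·e)^{−N}·𝒩₃(N) − (1 − 11/(15N) + 157/(126N²)) = O(1/N³). -/

import Mathlib

open Filter Asymptotics

/-- The number of magic cube series of order `N`: subsets of `{1,…,N³}` with `N`
elements summing to the magic constant `N(N³+1)/2`. -/
def magicCubeSeries (N : ℕ) : ℕ :=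
  ((Finset.Icc 1 (N ^ 3)).powerset.filter
    (fun S => S.card = N ∧ ∑ i ∈ S, i = N * (N ^ 3 + 1) / 2)).card

theorem sum_powersetCard_pow_mul_prod {R : Type*} [CommRing R] (z : R) (M k : ℕ) :
    (∑ S ∈ (Finset.Icc 1 M).powersetCard k, z ^ (∑ i ∈ S, i)) *
        ∏ i ∈ Finset.range k, (1 - z ^ (i + 1)) =
      ∏ i ∈ Finset.range k, (z ^ (i + 1) - z ^ (M + 1)) := by
  induction M generalizing k with
  | zero =>
    rcases k with _ | k
    · simp
    · rw [Finset.powersetCard_eq_empty.2 (by simp)]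
      rw [Finset.sum_empty, zero_mul, Finset.prod_eq_zero (Finset.mem_range.2 k.succ_pos)]
      simp
  | succ M ih =>
    rcases k with _ | k
    · simp
    · have hmem : M + 1 ∉ Finset.Icc 1 M := by simp
      have hrec : (∑ S ∈ (Finset.Icc 1 (M + 1)).powersetCard (k + 1), z ^ (∑ i ∈ S, i)) =
          (∑ S ∈ (Finset.Icc 1 M).powersetCard (k + 1), z ^ (∑ i ∈ S, i)) +
            z ^ (M + 1) * ∑ S ∈ (Finset.Icc 1 M).powersetCard k, z ^ (∑ i ∈ S, i) := by
        have hins : Finset.Icc 1 (M + 1) = insert (M + 1) (Finset.Icc 1 M) := by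
          ext x; simp; omega
        have hnot : ∀ S ∈ (Finset.Icc 1 M).powersetCard k, M + 1 ∉ S := fun S hS h =>
          hmem ((Finset.mem_powersetCard.1 hS).1 h)
        rw [hins, Finset.powersetCard_succ_insert hmem, Finset.sum_union, Finset.sum_image,
          Finset.mul_sum]
        · congr 1
          refine Finset.sum_congr rfl fun S hS => ?_
          rw [Finset.sum_insert (hnot S hS), pow_add]
        · intro S hS S' hS' h
          rw [← Finset.erase_insert (hnot S hS), ← Finset.erase_insert (hnot S' hS')]
          exact congrArg (fun s => s.erase (M + 1)) h
        · rw [Finset.disjoint_left]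
          intro S hS hS'
          obtain ⟨T, -, rfl⟩ := Finset.mem_image.1 hS'
          exact hmem ((Finset.mem_powersetCard.1 hS).1 (Finset.mem_insert_self _ _))
      have h1 := ih (k + 1)
      have h2 := ih k
      rw [hrec, add_mul, h1, mul_assoc, Finset.prod_range_succ (fun i => 1 - z ^ (i + 1)),
        ← mul_assoc (∑ S ∈ (Finset.Icc 1 M).powersetCard k, z ^ (∑ i ∈ S, i)), h2,
        Finset.prod_range_succ, Finset.prod_range_succ']
      have : ∀ i, z ^ (i + 1 + 1) - z ^ (M + 1 + 1) = z * (z ^ (i + 1) - z ^ (M + 1)) := by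
        intro i; ring
      simp_rw [this, Finset.prod_mul_distrib]
      simp only [Finset.prod_const, Finset.card_range]
      ring

theorem integral_exp_int_mul (n : ℤ) :
    ∫ t in -Real.pi..Real.pi, Complex.exp (t * n * Complex.I) =
      if n = 0 then 2 * (Real.pi : ℂ) else 0 := by
  split_ifs with h
  · subst h
    simp
    ring
  · have hc : (n * Complex.I : ℂ) ≠ 0 := by simp [h]
    have : ∀ t : ℝ, (t * n * Complex.I : ℂ) = (n * Complex.I) * t := fun t => by ring
    simp_rw [this]
    rw [integral_exp_mul_complex hc, div_eq_zero_iff]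
    left
    rw [sub_eq_zero, Complex.exp_eq_exp_iff_exists_int]
    exact ⟨n, by push_cast; ring⟩

theorem integral_cos_int_mul (n : ℤ) :
    ∫ t in -Real.pi..Real.pi, Real.cos (t * n) = if n = 0 then 2 * Real.pi else 0 := by
  split_ifs with h
  · subst h
    simp
    ring
  · have hn : (n : ℝ) ≠ 0 := by exact_mod_cast h
    rw [intervalIntegral.integral_comp_mul_right _ hn, integral_cos]
    have h1 : Real.sin (Real.pi * n) = 0 := by rw [mul_comm]; exact Real.sin_int_mul_pi n
    simp [h1]

theorem norm_one_add_le_exp (w : ℂ) : ‖1 + w‖ ≤ Real.exp (w.re + ‖w‖ ^ 2 / 2) := by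
  have h : ‖1 + w‖ ^ 2 = 2 * w.re + ‖w‖ ^ 2 + 1 := by
    rw [← Complex.normSq_eq_norm_sq, ← Complex.normSq_eq_norm_sq, Complex.normSq_apply,
      Complex.normSq_apply]
    simp
    ring
  refine le_of_sq_le_sq ?_ (Real.exp_pos _).le
  rw [h, ← Real.exp_nat_mul]
  refine (Real.add_one_le_exp _).trans (le_of_eq ?_)
  congr 1
  push_cast
  ring

theorem norm_sum_powersetCard_prod_mul_pow_le {s : Finset ℕ} {x : ℕ → ℂ}
    (hx : ∀ a ∈ s, ‖x a‖ = 1) (k : ℕ) {r : ℝ} (hr : 0 ≤ r) :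
    ‖∑ S ∈ s.powersetCard k, ∏ a ∈ S, x a‖ * r ^ k ≤
      Real.exp (r * ‖∑ a ∈ s, x a‖ + s.card * r ^ 2 / 2) := by
  have hint : ∫ t in -Real.pi..Real.pi,
      (∏ a ∈ s, (1 + r * Complex.exp (t * Complex.I) * x a)) * Complex.exp (-(t * k * Complex.I)) =
      2 * Real.pi * (r ^ k * ∑ S ∈ s.powersetCard k, ∏ a ∈ S, x a) := by
    have hexp : ∀ t : ℝ, (∏ a ∈ s, (1 + r * Complex.exp (t * Complex.I) * x a)) *
        Complex.exp (-(t * k * Complex.I)) =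
        ∑ S ∈ s.powerset, (r : ℂ) ^ S.card * (∏ a ∈ S, x a) *
          Complex.exp (t * ((S.card - k : ℤ) : ℂ) * Complex.I) := by
      intro t
      rw [Finset.prod_one_add, Finset.sum_mul]
      refine Finset.sum_congr rfl fun S _ => ?_
      rw [Finset.prod_mul_distrib, Finset.prod_const, mul_pow, ← Complex.exp_nat_mul]
      have : (t * ((S.card - k : ℤ) : ℂ) * Complex.I) =
        (S.card * (t * Complex.I)) + (-(t * k * Complex.I)) := by push_cast; ring
      rw [this, Complex.exp_add]
      ring
    simp_rw [hexp]
    rw [intervalIntegral.integral_finsetSum]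
    · simp_rw [intervalIntegral.integral_const_mul, integral_exp_int_mul]
      rw [Finset.powersetCard_eq_filter, Finset.sum_filter, Finset.mul_sum, Finset.mul_sum]
      refine Finset.sum_congr rfl fun S _ => ?_
      by_cases hS : S.card = k
      · simp [hS]
        ring
      · have : (S.card : ℤ) - k ≠ 0 := by omega
        simp [hS, this]
    · intro S _
      apply Continuous.intervalIntegrable
      fun_prop
  have hbound : ∀ t : ℝ, ‖(∏ a ∈ s, (1 + r * Complex.exp (t * Complex.I) * x a)) *
      Complex.exp (-(t * k * Complex.I))‖ ≤
      Real.exp (r * ‖∑ a ∈ s, x a‖ + s.card * r ^ 2 / 2) := by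
    intro t
    have h1 : ‖Complex.exp (-(t * k * Complex.I))‖ = 1 := by
      rw [Complex.norm_exp]; simp
    have h2 : ‖Complex.exp (t * Complex.I)‖ = 1 := Complex.norm_exp_ofReal_mul_I t
    rw [norm_mul, h1, mul_one, norm_prod]
    calc ∏ a ∈ s, ‖1 + r * Complex.exp (t * Complex.I) * x a‖
        ≤ ∏ a ∈ s, Real.exp ((r * Complex.exp (t * Complex.I) * x a).re + r ^ 2 / 2) := by
          refine Finset.prod_le_prod (fun _ _ => norm_nonneg _) fun a ha => ?_
          have hn : ‖r * Complex.exp (t * Complex.I) * x a‖ = r := by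
            rw [norm_mul, norm_mul, h2, hx a ha]
            simp [abs_of_nonneg hr]
          simpa only [hn] using norm_one_add_le_exp (r * Complex.exp (t * Complex.I) * x a)
      _ = Real.exp ((r * Complex.exp (t * Complex.I) * ∑ a ∈ s, x a).re + s.card * r ^ 2 / 2) := by
          rw [← Real.exp_sum, Finset.sum_add_distrib, Finset.mul_sum, Complex.re_sum,
            Finset.sum_const, nsmul_eq_mul, mul_div_assoc]
      _ ≤ _ := by
          gcongr
          refine (Complex.re_le_norm _).trans (le_of_eq ?_)
          rw [norm_mul, norm_mul, h2]
          simp [abs_of_nonneg hr]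
  have h := intervalIntegral.norm_integral_le_of_norm_le_const (a := -Real.pi) (b := Real.pi)
    fun t _ => hbound t
  rw [hint] at h
  have hpi := Real.pi_pos
  simp only [norm_mul, norm_pow, Complex.norm_real, Real.norm_eq_abs, abs_of_nonneg hr,
    abs_of_pos hpi, Complex.norm_ofNat, sub_neg_eq_add] at h
  rw [abs_of_pos (by positivity)] at h
  rw [mul_comm]
  nlinarith

/-- The real part of the characteristic sum of the `k`-subsets of `{1,…,M}`, with the subset sums
centred at their mean `k(M+1)/2`. -/
noncomputable def centeredCosSum (M k : ℕ) (t : ℝ) : ℝ :=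
  ∑ S ∈ (Finset.Icc 1 M).powersetCard k,
    Real.cos (t * (((∑ i ∈ S, i : ℕ) : ℝ) - k * (M + 1) / 2))

theorem continuous_centeredCosSum (M k : ℕ) : Continuous (centeredCosSum M k) := by
  unfold centeredCosSum
  fun_prop

theorem magicCubeSeries_eq_integral (N : ℕ) :
    (magicCubeSeries N : ℝ) =
      (2 * Real.pi)⁻¹ * ∫ t in -Real.pi..Real.pi, centeredCosSum (N ^ 3) N t := by
  have hdvd : 2 ∣ N * (N ^ 3 + 1) := by
    rcases Nat.even_or_odd N with h | h
    · exact dvd_mul_of_dvd_left h.two_dvd _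
    · exact dvd_mul_of_dvd_right (h.pow.add_odd odd_one).two_dvd _
  obtain ⟨T, hT⟩ := hdvd
  have hTr : (N : ℝ) * ((N ^ 3 : ℕ) + 1) / 2 = T := by
    have : ((N * (N ^ 3 + 1) : ℕ) : ℝ) = ((2 * T : ℕ) : ℝ) := by rw [hT]
    push_cast at this ⊢
    linarith
  unfold centeredCosSum
  rw [hTr, intervalIntegral.integral_finsetSum]
  · have hI : ∀ S : Finset ℕ, ∫ t in -Real.pi..Real.pi,
        Real.cos (t * (((∑ i ∈ S, i : ℕ) : ℝ) - T)) =
        if ∑ i ∈ S, i = T then 2 * Real.pi else 0 := by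
      intro S
      have h := integral_cos_int_mul (((∑ i ∈ S, i : ℕ) : ℤ) - T)
      have hiff : ((∑ i ∈ S, i : ℕ) : ℤ) - T = 0 ↔ ∑ i ∈ S, i = T := by omega
      simp only [hiff] at h
      rw [← h]
      norm_cast
    simp_rw [hI]
    rw [← Finset.sum_filter, Finset.sum_const, nsmul_eq_mul]
    have hpi := Real.pi_pos
    have hset : (Finset.Icc 1 (N ^ 3)).powerset.filter
        (fun S => S.card = N ∧ ∑ i ∈ S, i = N * (N ^ 3 + 1) / 2) =
        ((Finset.Icc 1 (N ^ 3)).powersetCard N).filter (fun S => ∑ i ∈ S, i = T) := by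
      have hT' : N * (N ^ 3 + 1) / 2 = T := by omega
      rw [Finset.powersetCard_eq_filter, Finset.filter_filter, hT']
    rw [magicCubeSeries, hset]
    field_simp
  · intro S _
    apply Continuous.intervalIntegrable
    fun_prop

theorem centeredCosSum_eq_re (M k : ℕ) (t : ℝ) :
    centeredCosSum M k t =
      ((∑ S ∈ (Finset.Icc 1 M).powersetCard k, Complex.exp (t * Complex.I) ^ (∑ i ∈ S, i)) *
        Complex.exp (-(t * (k * (M + 1) / 2 : ℝ)) * Complex.I)).re := by
  rw [centeredCosSum, Finset.sum_mul, Complex.re_sum]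
  refine Finset.sum_congr rfl fun S _ => ?_
  rw [← Complex.exp_nat_mul, ← Complex.exp_add, ← Complex.exp_ofReal_mul_I_re]
  congr 2
  push_cast
  ring

theorem centeredCosSum_mul_prod_sin (M k : ℕ) (t : ℝ) :
    centeredCosSum M k t * ∏ i ∈ Finset.range k, Real.sin ((i + 1) * (t / 2)) =
      ∏ i ∈ Finset.range k, Real.sin ((M - i) * (t / 2)) := by
  obtain ⟨c, hc⟩ : ∃ c, c = -2 * Complex.I := ⟨_, rfl⟩
  have hc0 : c ≠ 0 := by simp [hc]
  have hsin : ∀ x : ℝ, (Real.sin x : ℂ) * c =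
      Complex.exp (-x * Complex.I) - Complex.exp (x * Complex.I) := by
    intro x
    rw [Complex.ofReal_sin, Complex.sin, hc]
    linear_combination (Complex.exp (x * Complex.I) - Complex.exp (-x * Complex.I)) *
      Complex.I_sq
  have h1 : ∀ i : ℕ, 1 - Complex.exp (t * Complex.I) ^ (i + 1) =
      Complex.exp ((i + 1) * (t / 2) * Complex.I) * c *
        (Real.sin ((i + 1) * (t / 2)) : ℂ) := by
    intro i
    rw [mul_assoc, mul_comm c, hsin, mul_sub, ← Complex.exp_add, ← Complex.exp_add,
      ← Complex.exp_nat_mul]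
    congr 1
    · rw [eq_comm, Complex.exp_eq_one_iff]
      exact ⟨0, by push_cast; ring⟩
    · congr 1
      push_cast
      ring
  have h2 : ∀ i : ℕ, Complex.exp (t * Complex.I) ^ (i + 1) - Complex.exp (t * Complex.I) ^ (M + 1) =
      Complex.exp ((i + 1) * (t / 2) * Complex.I) * c *
        (Complex.exp ((M + 1) * (t / 2) * Complex.I) * (Real.sin ((M - i) * (t / 2)) : ℂ)) := by
    intro i
    rw [mul_mul_mul_comm, mul_comm c, hsin, mul_sub,
      ← Complex.exp_add, ← Complex.exp_add, ← Complex.exp_add,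
      ← Complex.exp_nat_mul, ← Complex.exp_nat_mul]
    congr 2 <;> (push_cast; ring)
  obtain ⟨e, he⟩ : ∃ e : ℕ → ℂ, ∀ i, e i = Complex.exp ((i + 1) * (t / 2) * Complex.I) * c :=
    ⟨_, fun _ => rfl⟩
  have hne : ∏ i ∈ Finset.range k, e i ≠ 0 :=
    Finset.prod_ne_zero_iff.2 fun i _ => he i ▸ mul_ne_zero (Complex.exp_ne_zero _) hc0
  have hq := sum_powersetCard_pow_mul_prod (Complex.exp (t * Complex.I)) M k
  simp_rw [h1, h2, ← he] at hq
  rw [Finset.prod_mul_distrib, Finset.prod_mul_distrib, Finset.prod_mul_distrib,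
    Finset.prod_const, Finset.card_range, mul_left_comm] at hq
  have hq' := mul_left_cancel₀ hne hq
  have hE : Complex.exp ((M + 1) * (t / 2) * Complex.I) ^ k *
      Complex.exp (-(t * (k * (M + 1) / 2 : ℝ)) * Complex.I) = 1 := by
    rw [← Complex.exp_nat_mul, ← Complex.exp_add, Complex.exp_eq_one_iff]
    exact ⟨0, by push_cast; ring⟩
  rw [centeredCosSum_eq_re, ← Complex.re_mul_ofReal,
    ← Complex.ofReal_re (∏ i ∈ Finset.range k, Real.sin ((M - i) * (t / 2)))]
  congr 1
  rw [Complex.ofReal_prod, Complex.ofReal_prod, mul_right_comm, hq', mul_right_comm, hE, one_mul]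

theorem norm_sum_Icc_exp_le {M : ℕ} {t : ℝ} (ht : t ≠ 0) (htpi : |t| ≤ Real.pi) :
    ‖∑ a ∈ Finset.Icc 1 M, Complex.exp (t * Complex.I) ^ a‖ ≤ Real.pi / |t| := by
  set z := Complex.exp (t * Complex.I) with hz
  have hnorm : ‖z‖ = 1 := Complex.norm_exp_ofReal_mul_I t
  have hgeom : (∑ a ∈ Finset.Icc 1 M, z ^ a) * (z - 1) = z ^ (M + 1) - z := by
    induction M with
    | zero => simp
    | succ M ih =>
      rw [Finset.sum_Icc_succ_top (by omega), add_mul, ih]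
      ring
  have hpi := Real.pi_pos
  have htpos : 0 < |t| := abs_pos.2 ht
  have hlow : 2 * |t| / Real.pi ≤ ‖z - 1‖ := by
    rw [hz, mul_comm (t : ℂ), Complex.norm_exp_I_mul_ofReal_sub_one, Real.norm_eq_abs, abs_mul, abs_two]
    have := Real.mul_abs_le_abs_sin (x := t / 2) (by rw [abs_div, abs_two]; linarith)
    rw [abs_div, abs_two] at this
    calc 2 * |t| / Real.pi = 2 * (2 / Real.pi * (|t| / 2)) := by field_simp
      _ ≤ _ := by linarith
  have hup : ‖∑ a ∈ Finset.Icc 1 M, z ^ a‖ * ‖z - 1‖ ≤ 2 := by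
    rw [← norm_mul, hgeom]
    refine (norm_sub_le _ _).trans ?_
    rw [norm_pow, hnorm]
    norm_num
  have h3 : ‖∑ a ∈ Finset.Icc 1 M, z ^ a‖ * (2 * |t| / Real.pi) ≤ 2 :=
    (mul_le_mul_of_nonneg_left hlow (norm_nonneg _)).trans hup
  rw [le_div_iff₀ htpos]
  rw [mul_div_assoc', div_le_iff₀ hpi] at h3
  linarith

theorem abs_centeredCosSum_le (M k : ℕ) (t : ℝ) {r : ℝ} (hr : 0 ≤ r) :
    |centeredCosSum M k t| * r ^ k ≤
      Real.exp (r * ‖∑ a ∈ Finset.Icc 1 M, Complex.exp (t * Complex.I) ^ a‖ + M * r ^ 2 / 2) := by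
  have h := norm_sum_powersetCard_prod_mul_pow_le (s := Finset.Icc 1 M)
    (x := fun a => Complex.exp (t * Complex.I) ^ a)
    (fun a _ => by rw [norm_pow, Complex.norm_exp_ofReal_mul_I, one_pow]) k hr
  simp only [Finset.prod_pow_eq_pow_sum _ (fun a => a), Nat.card_Icc, Nat.add_sub_cancel] at h
  refine le_trans ?_ h
  gcongr
  rw [centeredCosSum_eq_re]
  refine (Complex.abs_re_le_norm _).trans (le_of_eq ?_)
  rw [norm_mul, ← Complex.ofReal_mul, ← Complex.ofReal_neg, Complex.norm_exp_ofReal_mul_I, mul_one]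

theorem hasSum_zeta_six : HasSum (fun n : ℕ => (1 : ℝ) / (n : ℝ) ^ 6) (Real.pi ^ 6 / 945) := by
  have hb : bernoulli 6 = 1 / 42 := by
    have h3 : Nat.choose 6 2 = 15 := rfl
    have h4 : Nat.choose 6 3 = 20 := rfl
    have h5 : Nat.choose 6 4 = 15 := rfl
    have hb5 : bernoulli' 5 = 0 := bernoulli'_eq_zero_of_odd (by decide) (by norm_num)
    rw [bernoulli_eq_bernoulli'_of_ne_one (by norm_num), bernoulli'_def]
    norm_num [Finset.sum_range_succ, h3, h4, h5, hb5]
  convert! hasSum_zeta_nat (k := 3) (by norm_num) using 1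
  norm_num [hb, Nat.factorial]
  ring

theorem tendsto_sum_one_div_succ_pow {k : ℕ} (hk : k ≠ 0) {c : ℝ}
    (h : HasSum (fun n : ℕ => (1 : ℝ) / (n : ℝ) ^ k) c) :
    Tendsto (fun n => ∑ j ∈ Finset.range n, 1 / ((j : ℝ) + 1) ^ k) atTop (nhds c) := by
  have := (hasSum_nat_add_iff' 1).2 h
  simp only [Finset.sum_range_one, Nat.cast_zero, zero_pow hk, div_zero, sub_zero, Nat.cast_add,
    Nat.cast_one] at this
  exact this.tendsto_sum_nat

theorem sinc_pos_of_abs_le_two {x : ℝ} (hx : |x| ≤ 2) : 0 < Real.sinc x := by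
  have hpi := Real.pi_gt_three
  rcases eq_or_ne x 0 with rfl | h0
  · simp
  · wlog hpos : 0 < x generalizing x
    · rw [← Real.sinc_neg]
      exact this (by rwa [abs_neg]) (neg_ne_zero.2 h0)
        (neg_pos.2 (lt_of_le_of_ne (not_lt.1 hpos) h0))
    · rw [Real.sinc_of_ne_zero h0]
      exact div_pos (Real.sin_pos_of_pos_of_lt_pi hpos (by linarith [le_abs_self x])) hpos

theorem div_pi_sq_div_le {x : ℝ} (hx : |x| ≤ 2) (j : ℕ) :
    (x / Real.pi) ^ 2 / ((j : ℝ) + 1) ^ 2 ≤ 1 / 2 := by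
  have hpi := Real.pi_gt_three
  have h1 : (x / Real.pi) ^ 2 ≤ 1 / 2 := by
    have : x ^ 2 ≤ 4 := by nlinarith [sq_abs x, abs_nonneg x]
    rw [div_pow, div_le_iff₀ (by positivity)]
    nlinarith
  have h2 : (1 : ℝ) ≤ ((j : ℝ) + 1) ^ 2 := one_le_pow₀ (by linarith [Nat.cast_nonneg (α := ℝ) j])
  rw [div_le_iff₀ (by positivity)]
  nlinarith

theorem tendsto_sum_log_sinc {x : ℝ} (hx : |x| ≤ 2) :
    Tendsto (fun n => ∑ j ∈ Finset.range n,
      Real.log (1 - (x / Real.pi) ^ 2 / ((j : ℝ) + 1) ^ 2)) atTop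
      (nhds (Real.log (Real.sinc x))) := by
  rcases eq_or_ne x 0 with rfl | h0
  · simp
  · have hpi := Real.pi_pos
    have h := Real.tendsto_euler_sin_prod (x / Real.pi)
    rw [mul_div_cancel₀ _ hpi.ne'] at h
    have h2 := h.div_const x
    rw [← Real.sinc_of_ne_zero h0] at h2
    simp_rw [mul_div_cancel_left₀ _ h0] at h2
    refine (h2.log (sinc_pos_of_abs_le_two hx).ne').congr fun n => ?_
    rw [Real.log_prod]
    intro j _
    have := div_pi_sq_div_le hx j
    linarith

theorem abs_log_one_sub_add_le {y : ℝ} (h0 : 0 ≤ y) (h1 : y ≤ 1 / 2) :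
    |Real.log (1 - y) + y + y ^ 2 / 2 + y ^ 3 / 3| ≤ 2 * y ^ 4 := by
  have h := Real.abs_log_sub_add_sum_range_le (x := y) (by rw [abs_of_nonneg h0]; linarith) 3
  rw [abs_of_nonneg h0] at h
  simp only [Finset.sum_range_succ, Finset.sum_range_zero] at h
  have h2 : y ^ (3 + 1) / (1 - y) ≤ 2 * y ^ 4 := by
    rw [div_le_iff₀ (by linarith)]
    change y ^ 4 ≤ _
    nlinarith [mul_nonneg (pow_nonneg h0 4) (by linarith : 0 ≤ 1 - 2 * y)]
  refine le_trans (le_of_eq ?_) (h.trans h2)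
  congr 1
  push_cast
  ring

theorem abs_log_sinc_add_le {x : ℝ} (hx : |x| ≤ 2) :
    |Real.log (Real.sinc x) + x ^ 2 / 6 + x ^ 4 / 180 + x ^ 6 / 2835| ≤ x ^ 8 := by
  have hpi := Real.pi_gt_three
  set a := x / Real.pi with ha
  have hz2 := tendsto_sum_one_div_succ_pow two_ne_zero hasSum_zeta_two
  have hz4 := tendsto_sum_one_div_succ_pow four_ne_zero hasSum_zeta_four
  have hz6 := tendsto_sum_one_div_succ_pow (by norm_num) hasSum_zeta_six
  have h := (((tendsto_sum_log_sinc hx).add (hz2.const_mul (a ^ 2))).add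
    (hz4.const_mul (a ^ 4 / 2))).add (hz6.const_mul (a ^ 6 / 3))
  have e2 : a ^ 2 * (Real.pi ^ 2 / 6) = x ^ 2 / 6 := by rw [ha]; field_simp
  have e4 : a ^ 4 / 2 * (Real.pi ^ 4 / 90) = x ^ 4 / 180 := by rw [ha]; field_simp; ring
  have e6 : a ^ 6 / 3 * (Real.pi ^ 6 / 945) = x ^ 6 / 2835 := by rw [ha]; field_simp; ring
  rw [e2, e4, e6] at h
  refine le_of_tendsto_of_tendsto h.abs (hz4.const_mul (2 * a ^ 8)) ?_ |>.trans ?_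
  · filter_upwards with n
    rw [Finset.mul_sum, Finset.mul_sum, Finset.mul_sum, Finset.mul_sum,
      ← Finset.sum_add_distrib, ← Finset.sum_add_distrib, ← Finset.sum_add_distrib]
    refine (Finset.abs_sum_le_sum_abs _ _).trans (Finset.sum_le_sum fun j _ => ?_)
    have hj : (1 : ℝ) ≤ (j : ℝ) + 1 := by linarith [Nat.cast_nonneg (α := ℝ) j]
    refine le_trans (le_of_eq ?_) ((abs_log_one_sub_add_le (by positivity)
      (div_pi_sq_div_le hx j)).trans ?_)
    · congr 1
      rw [← ha]
      field_simp
    · rw [← ha, div_pow, ← pow_mul, ← pow_mul, mul_assoc]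
      have : ((j : ℝ) + 1) ^ 4 ≤ ((j : ℝ) + 1) ^ (2 * 4) := pow_le_pow_right₀ hj (by norm_num)
      rw [mul_one_div]
      gcongr
  · have e8 : 2 * a ^ 8 * (Real.pi ^ 4 / 90) = x ^ 8 * (2 / (90 * Real.pi ^ 4)) := by
      rw [ha]
      field_simp
    rw [e8]
    have : 2 / (90 * Real.pi ^ 4) ≤ 1 := by
      rw [div_le_one (by positivity)]
      have : (1 : ℝ) ≤ Real.pi ^ 4 := one_le_pow₀ (by linarith)
      linarith
    nlinarith [show 0 ≤ x ^ 8 by positivity]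

theorem log_sinc_le {x : ℝ} (hx : |x| ≤ 2) : Real.log (Real.sinc x) ≤ -(x ^ 2 / 6) := by
  have hpi := Real.pi_pos
  have hz2 := tendsto_sum_one_div_succ_pow two_ne_zero hasSum_zeta_two
  have e2 : (x / Real.pi) ^ 2 * (Real.pi ^ 2 / 6) = x ^ 2 / 6 := by field_simp
  have h2 := (hz2.const_mul ((x / Real.pi) ^ 2)).neg
  rw [e2] at h2
  refine le_of_tendsto_of_tendsto (tendsto_sum_log_sinc hx) h2 ?_
  filter_upwards with n
  rw [Finset.mul_sum, ← Finset.sum_neg_distrib]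
  refine Finset.sum_le_sum fun j _ => ?_
  have hj := div_pi_sq_div_le hx j
  refine (Real.log_le_sub_one_of_pos (by linarith)).trans (le_of_eq ?_)
  ring

theorem abs_log_sinc_le {x : ℝ} (hx : |x| ≤ 2) : |Real.log (Real.sinc x)| ≤ 66 * x ^ 2 := by
  have hy : x ^ 2 ≤ 4 := by nlinarith [sq_abs x, abs_nonneg x]
  have h := abs_le.1 (abs_log_sinc_add_le hx)
  have h0 := sq_nonneg x
  have h4 : x ^ 4 ≤ 4 * x ^ 2 := by nlinarith
  have h6 : x ^ 6 ≤ 16 * x ^ 2 := by nlinarith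
  have h8 : x ^ 8 ≤ 64 * x ^ 2 := by nlinarith
  have := log_sinc_le hx
  rw [abs_le]
  constructor <;> linarith

theorem sin_eq_mul_sinc (x : ℝ) : Real.sin x = x * Real.sinc x := by
  rcases eq_or_ne x 0 with rfl | h
  · simp
  · rw [Real.sinc_of_ne_zero h, mul_div_cancel₀ _ h]

/-- The logarithm of `∏ sinc ((1 - i/N³)u) / sinc ((i+1)u/N³)`. -/
noncomputable def logSincRatio (N : ℕ) (u : ℝ) : ℝ :=
  ∑ i ∈ Finset.range N, (Real.log (Real.sinc ((1 - i / (N : ℝ) ^ 3) * u)) -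
    Real.log (Real.sinc ((i + 1) / (N : ℝ) ^ 3 * u)))

theorem cast_div_cube_bounds {N i : ℕ} (hi : i ∈ Finset.range N) :
    0 ≤ (i : ℝ) / (N : ℝ) ^ 3 ∧ ((i : ℝ) + 1) / (N : ℝ) ^ 3 ≤ 1 / (N : ℝ) ^ 2 ∧
      1 / (N : ℝ) ^ 2 ≤ 1 := by
  have hiN : (i : ℝ) + 1 ≤ N := by exact_mod_cast Finset.mem_range.1 hi
  have hN : (1 : ℝ) ≤ N := by linarith [Nat.cast_nonneg (α := ℝ) i]
  refine ⟨by positivity, ?_, ?_⟩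
  · rw [div_le_div_iff₀ (by positivity) (by positivity)]
    nlinarith [show (0 : ℝ) ≤ (N : ℝ) ^ 2 by positivity]
  · rw [div_le_one (by positivity)]
    exact one_le_pow₀ hN

theorem abs_mul_le_two_of_mem {e u : ℝ} (h0 : 0 ≤ e) (h1 : e ≤ 1) (hu : |u| ≤ 2) :
    |e * u| ≤ 2 := by
  rw [abs_mul, abs_of_nonneg h0]
  nlinarith [abs_nonneg u]

theorem centeredCosSum_eq_exp {N : ℕ} {u : ℝ} (hu : |u| ≤ 2) (hu0 : u ≠ 0) :
    centeredCosSum (N ^ 3) N (2 * u / (N : ℝ) ^ 3) =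
      ((N : ℝ) ^ 3) ^ N / N.factorial * (∏ i ∈ Finset.range N, (1 - (i : ℝ) / (N : ℝ) ^ 3)) *
        Real.exp (logSincRatio N u) := by
  have h := centeredCosSum_mul_prod_sin (N ^ 3) N (2 * u / (N : ℝ) ^ 3)
  have hpos1 : ∀ i ∈ Finset.range N, 0 < Real.sinc ((1 - i / (N : ℝ) ^ 3) * u) := by
    intro i hi
    obtain ⟨h0, h1, h2⟩ := cast_div_cube_bounds hi
    rw [add_div] at h1
    have : 0 ≤ 1 / (N : ℝ) ^ 3 := by positivity
    exact sinc_pos_of_abs_le_two (abs_mul_le_two_of_mem (by linarith) (by linarith) hu)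
  have hpos2 : ∀ i ∈ Finset.range N, 0 < Real.sinc ((i + 1) / (N : ℝ) ^ 3 * u) := by
    intro i hi
    obtain ⟨h0, h1, h2⟩ := cast_div_cube_bounds hi
    exact sinc_pos_of_abs_le_two (abs_mul_le_two_of_mem (by positivity) (by linarith) hu)
  have hexp : Real.exp (logSincRatio N u) * ∏ i ∈ Finset.range N,
      Real.sinc ((i + 1) / (N : ℝ) ^ 3 * u) =
      ∏ i ∈ Finset.range N, Real.sinc ((1 - i / (N : ℝ) ^ 3) * u) := by
    rw [logSincRatio, Real.exp_sum, ← Finset.prod_mul_distrib]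
    refine Finset.prod_congr rfl fun i hi => ?_
    rw [Real.exp_sub, Real.exp_log (hpos1 i hi), Real.exp_log (hpos2 i hi),
      div_mul_cancel₀ _ (hpos2 i hi).ne']
  have hl : ∏ i ∈ Finset.range N, Real.sin ((i + 1) * (2 * u / (N : ℝ) ^ 3 / 2)) =
      N.factorial * (u / (N : ℝ) ^ 3) ^ N *
        ∏ i ∈ Finset.range N, Real.sinc ((i + 1) / (N : ℝ) ^ 3 * u) := by
    rw [← Finset.prod_range_add_one_eq_factorial]
    push_cast
    rw [← Finset.card_range N, ← Finset.prod_const, Finset.card_range,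
      ← Finset.prod_mul_distrib, ← Finset.prod_mul_distrib]
    refine Finset.prod_congr rfl fun i _ => ?_
    rw [show ((i : ℝ) + 1) * (2 * u / (N : ℝ) ^ 3 / 2) = (i + 1) / (N : ℝ) ^ 3 * u by ring,
      sin_eq_mul_sinc]
    ring
  have hr : ∏ i ∈ Finset.range N, Real.sin (((N ^ 3 : ℕ) - i) * (2 * u / (N : ℝ) ^ 3 / 2)) =
      (∏ i ∈ Finset.range N, (1 - (i : ℝ) / (N : ℝ) ^ 3)) * u ^ N *
        ∏ i ∈ Finset.range N, Real.sinc ((1 - i / (N : ℝ) ^ 3) * u) := by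
    conv_rhs => rw [← Finset.card_range N, ← Finset.prod_const, Finset.card_range]
    rw [← Finset.prod_mul_distrib, ← Finset.prod_mul_distrib]
    refine Finset.prod_congr rfl fun i hi => ?_
    have hN : (N : ℝ) ≠ 0 := by
      have := Finset.mem_range.1 hi
      exact_mod_cast (by omega : N ≠ 0)
    rw [show (((N ^ 3 : ℕ) : ℝ) - i) * (2 * u / (N : ℝ) ^ 3 / 2) = (1 - i / (N : ℝ) ^ 3) * u by
      push_cast
      field_simp, sin_eq_mul_sinc]
  rw [hl, hr, ← hexp] at h
  have hne : ∏ i ∈ Finset.range N, Real.sinc ((i + 1) / (N : ℝ) ^ 3 * u) ≠ 0 :=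
    Finset.prod_ne_zero_iff.2 fun i hi => (hpos2 i hi).ne'
  have hf : (N.factorial : ℝ) ≠ 0 := by exact_mod_cast N.factorial_ne_zero
  rcases Nat.eq_zero_or_pos N with rfl | hNpos
  · simpa [logSincRatio] using h
  have hN : (N : ℝ) ≠ 0 := by exact_mod_cast hNpos.ne'
  have hu' : u ^ N ≠ 0 := pow_ne_zero _ hu0
  generalize centeredCosSum (N ^ 3) N (2 * u / (N : ℝ) ^ 3) = F at h ⊢
  generalize ∏ i ∈ Finset.range N, Real.sinc ((i + 1) / (N : ℝ) ^ 3 * u) = P at h hne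
  generalize ∏ i ∈ Finset.range N, (1 - (i : ℝ) / (N : ℝ) ^ 3) = Q at h ⊢
  generalize Real.exp (logSincRatio N u) = E at h ⊢
  rw [div_pow] at h
  refine mul_right_cancel₀ (mul_ne_zero hne hu') ?_
  generalize u ^ N = v at h hu' ⊢
  generalize hV : ((N : ℝ) ^ 3) ^ N = V at h ⊢
  have hV0 : V ≠ 0 := hV ▸ pow_ne_zero _ (pow_ne_zero _ hN)
  field_simp at h ⊢
  linear_combination h

theorem logSincRatio_summand_bound {N i : ℕ} (hi : i ∈ Finset.range N) {u : ℝ} (hu : |u| ≤ 2) :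
    |Real.log (Real.sinc ((1 - i / (N : ℝ) ^ 3) * u)) -
      Real.log (Real.sinc ((i + 1) / (N : ℝ) ^ 3 * u)) +
      (u ^ 2 / 6 * (1 - 2 * (i / (N : ℝ) ^ 3)) + u ^ 4 / 180 + u ^ 6 / 2835)| ≤
      u ^ 8 + 67 * u ^ 2 * (1 / (N : ℝ) ^ 2) ^ 2 + u ^ 4 * (1 / (N : ℝ) ^ 2) := by
  obtain ⟨h0, h1, h2⟩ := cast_div_cube_bounds hi
  have hf0 : 0 ≤ ((i : ℝ) + 1) / (N : ℝ) ^ 3 := by positivity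
  have he1 : (i : ℝ) / (N : ℝ) ^ 3 ≤ 1 / (N : ℝ) ^ 2 := by
    rw [add_div] at h1
    have : 0 ≤ 1 / (N : ℝ) ^ 3 := by positivity
    linarith
  generalize (i : ℝ) / (N : ℝ) ^ 3 = e at *
  generalize ((i : ℝ) + 1) / (N : ℝ) ^ 3 = f at *
  generalize 1 / (N : ℝ) ^ 2 = m at *
  have hA := abs_le.1 (abs_log_sinc_add_le
    (abs_mul_le_two_of_mem (by linarith : 0 ≤ 1 - e) (by linarith) hu))
  have hB := abs_le.1 (abs_log_sinc_le (abs_mul_le_two_of_mem hf0 (by linarith) hu))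
  have hu2 : u ^ 2 ≤ 4 := by nlinarith [sq_abs u, abs_nonneg u]
  have hu0 := sq_nonneg u
  have hu4 : 0 ≤ u ^ 4 := by positivity
  have hu6 : u ^ 6 ≤ 4 * u ^ 4 := by nlinarith
  have hu60 : 0 ≤ u ^ 6 := by positivity
  have p2 : (f * u) ^ 2 ≤ u ^ 2 * m ^ 2 := by
    rw [mul_pow, mul_comm]
    gcongr
  have e2 : e ^ 2 ≤ m ^ 2 := by gcongr
  have q2 : u ^ 2 * e ^ 2 ≤ u ^ 2 * m ^ 2 := by gcongr
  have hone : ∀ k : ℕ, 1 - k * e ≤ (1 - e) ^ k := by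
    intro k
    have := one_add_mul_le_pow (a := -e) (by linarith) k
    rw [← sub_eq_add_neg] at this
    linarith
  have hle : ∀ k : ℕ, (1 - e) ^ k ≤ 1 := fun k => pow_le_one₀ (by linarith) (by linarith)
  have r4 : u ^ 4 * (1 - 4 * e) ≤ ((1 - e) * u) ^ 4 := by
    rw [mul_pow, mul_comm]
    have := hone 4
    push_cast at this
    gcongr
  have r4' : ((1 - e) * u) ^ 4 ≤ u ^ 4 := by
    rw [mul_pow]
    exact mul_le_of_le_one_left hu4 (hle 4)
  have r6 : u ^ 6 * (1 - 6 * e) ≤ ((1 - e) * u) ^ 6 := by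
    rw [mul_pow, mul_comm]
    have := hone 6
    push_cast at this
    gcongr
  have r6' : ((1 - e) * u) ^ 6 ≤ u ^ 6 := by
    rw [mul_pow]
    exact mul_le_of_le_one_left hu60 (hle 6)
  have r8' : ((1 - e) * u) ^ 8 ≤ u ^ 8 := by
    rw [mul_pow]
    exact mul_le_of_le_one_left (by positivity) (hle 8)
  have r2 : ((1 - e) * u) ^ 2 = u ^ 2 * (1 - 2 * e) + u ^ 2 * e ^ 2 := by ring
  have s4 : u ^ 4 * e ≤ u ^ 4 * m := by gcongr
  have s6 : u ^ 6 * e ≤ 4 * (u ^ 4 * m) :=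
    calc u ^ 6 * e ≤ 4 * u ^ 4 * m := by gcongr
      _ = _ := by ring
  have t0 : 0 ≤ u ^ 2 * e ^ 2 := by positivity
  rw [abs_le]
  constructor <;> nlinarith

theorem sum_range_cast_div_cube {N : ℕ} (hN : 0 < N) :
    ∑ i ∈ Finset.range N, (i : ℝ) / (N : ℝ) ^ 3 = 1 / (2 * N) - 1 / (2 * (N : ℝ) ^ 2) := by
  have h : ∑ i ∈ Finset.range N, (i : ℝ) = N * (N - 1) / 2 := by
    clear hN
    induction N with
    | zero => simp
    | succ n ih =>
      rw [Finset.sum_range_succ, ih]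
      push_cast
      ring
  have hN' : (N : ℝ) ≠ 0 := by exact_mod_cast hN.ne'
  rw [← Finset.sum_div, h]
  field_simp

theorem abs_logSincRatio_add_le {N : ℕ} (hN : 0 < N) {u : ℝ} (hu : |u| ≤ 2) :
    |logSincRatio N u + N * u ^ 2 / 6 -
      (u ^ 2 / (6 * N) - N * u ^ 4 / 180 - N * u ^ 6 / 2835)| ≤
      N * u ^ 8 + 68 * (u ^ 2 / (N : ℝ) ^ 2) + u ^ 4 / N := by
  have h := Finset.abs_sum_le_sum_abs (fun i : ℕ => Real.log (Real.sinc ((1 - i / (N : ℝ) ^ 3) * u)) -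
      Real.log (Real.sinc ((i + 1) / (N : ℝ) ^ 3 * u)) +
      (u ^ 2 / 6 * (1 - 2 * (i / (N : ℝ) ^ 3)) + u ^ 4 / 180 + u ^ 6 / 2835)) (Finset.range N)
  have h' := h.trans (Finset.sum_le_sum fun i hi => logSincRatio_summand_bound hi hu)
  rw [Finset.sum_add_distrib, ← logSincRatio, Finset.sum_const, Finset.card_range, nsmul_eq_mul,
    Finset.sum_add_distrib, Finset.sum_add_distrib, Finset.sum_const, Finset.sum_const,
    Finset.card_range, nsmul_eq_mul, nsmul_eq_mul, ← Finset.mul_sum, Finset.sum_sub_distrib,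
    ← Finset.mul_sum, sum_range_cast_div_cube hN, Finset.sum_const, Finset.card_range,
    nsmul_eq_mul, mul_one] at h'
  have hN1 : (1 : ℝ) ≤ N := by exact_mod_cast hN
  have hb : |u ^ 2 / (6 * (N : ℝ) ^ 2)| ≤ u ^ 2 / (N : ℝ) ^ 2 := by
    rw [abs_of_nonneg (by positivity)]
    gcongr
    nlinarith [show (0 : ℝ) ≤ (N : ℝ) ^ 2 by positivity]
  have hc : N * (67 * u ^ 2 * (1 / (N : ℝ) ^ 2) ^ 2) ≤ 67 * (u ^ 2 / (N : ℝ) ^ 2) := by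
    have : N * (67 * u ^ 2 * (1 / (N : ℝ) ^ 2) ^ 2) = 67 * (u ^ 2 / (N : ℝ) ^ 3) := by
      field_simp
    rw [this]
    gcongr
    · norm_num
  have hd : N * (u ^ 4 * (1 / (N : ℝ) ^ 2)) = u ^ 4 / N := by field_simp
  rw [mul_add, mul_add, hd] at h'
  refine le_trans ?_ (le_trans (add_le_add h' hb) (by linarith))
  refine le_trans (le_of_eq ?_) (abs_sub _ _)
  congr 1
  field_simp
  ring

theorem logSincRatio_add_le_one {N : ℕ} (hN : 10 ≤ N) {u : ℝ} (hu : |u| ≤ 2) :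
    logSincRatio N u + N * u ^ 2 / 6 ≤ 1 := by
  have hterm : ∀ i ∈ Finset.range N, Real.log (Real.sinc ((1 - i / (N : ℝ) ^ 3) * u)) -
      Real.log (Real.sinc ((i + 1) / (N : ℝ) ^ 3 * u)) ≤
      -(u ^ 2 / 6) + u ^ 2 / 3 * (1 / (N : ℝ) ^ 2) + 66 * u ^ 2 * (1 / (N : ℝ) ^ 2) ^ 2 := by
    intro i hi
    obtain ⟨h0, h1, h2⟩ := cast_div_cube_bounds hi
    have hf0 : 0 ≤ ((i : ℝ) + 1) / (N : ℝ) ^ 3 := by positivity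
    have he1 : (i : ℝ) / (N : ℝ) ^ 3 ≤ 1 / (N : ℝ) ^ 2 := by
      rw [add_div] at h1
      have : 0 ≤ 1 / (N : ℝ) ^ 3 := by positivity
      linarith
    generalize (i : ℝ) / (N : ℝ) ^ 3 = e at *
    generalize ((i : ℝ) + 1) / (N : ℝ) ^ 3 = f at *
    generalize 1 / (N : ℝ) ^ 2 = m at *
    have hA := log_sinc_le (abs_mul_le_two_of_mem (by linarith : 0 ≤ 1 - e) (by linarith) hu)
    have hB := abs_le.1 (abs_log_sinc_le (abs_mul_le_two_of_mem hf0 (by linarith) hu))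
    have p2 : (f * u) ^ 2 ≤ u ^ 2 * m ^ 2 := by
      rw [mul_pow, mul_comm]
      gcongr
    have r2 : ((1 - e) * u) ^ 2 = u ^ 2 - 2 * (u ^ 2 * e) + u ^ 2 * e ^ 2 := by ring
    have q : u ^ 2 * e ≤ u ^ 2 * m := by gcongr
    have t0 : 0 ≤ u ^ 2 * e ^ 2 := by positivity
    linarith
  have h := Finset.sum_le_sum hterm
  rw [← logSincRatio, Finset.sum_const, Finset.card_range, nsmul_eq_mul] at h
  have hN1 : (10 : ℝ) ≤ N := by exact_mod_cast hN
  have hu2 : u ^ 2 ≤ 4 := by nlinarith [sq_abs u, abs_nonneg u]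
  have hm : N * (u ^ 2 / 3 * (1 / (N : ℝ) ^ 2) + 66 * u ^ 2 * (1 / (N : ℝ) ^ 2) ^ 2) =
      u ^ 2 * (1 / N / 3 + 66 * (1 / N) ^ 3) := by field_simp
  have hn : 1 / (N : ℝ) ≤ 1 / 10 := by gcongr
  have hn0 : 0 ≤ 1 / (N : ℝ) := by positivity
  have hn3 : (1 / (N : ℝ)) ^ 3 ≤ (1 / 10) ^ 3 := by gcongr
  have : u ^ 2 * (1 / N / 3 + 66 * (1 / N) ^ 3) ≤ 4 * (1 / 10 / 3 + 66 * (1 / 10) ^ 3) := by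
    gcongr
  have h5 : (4 : ℝ) * (1 / 10 / 3 + 66 * (1 / 10) ^ 3) ≤ 1 := by norm_num
  rw [add_assoc, mul_add, hm] at h
  linarith

theorem abs_exp_sub_quadratic_le {h : ℝ} (hh : h ≤ 1) :
    |Real.exp h - (1 + h + h ^ 2 / 2)| ≤ 3 * |h| ^ 3 := by
  rcases le_or_gt |h| 1 with h1 | h1
  · have := Real.exp_bound h1 (n := 3) (by norm_num)
    norm_num [Finset.sum_range_succ, Nat.factorial] at this
    have h3 : 0 ≤ |h| ^ 3 := by positivity
    linarith
  · have hneg : h < -1 := by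
      rcases lt_abs.1 h1 with h2 | h2 <;> linarith
    have he : Real.exp h ≤ 1 := Real.exp_le_one_iff.2 (by linarith)
    have he0 := Real.exp_pos h
    rw [abs_of_neg (by linarith : h < 0)]
    obtain ⟨y, rfl⟩ : ∃ y, h = -y := ⟨-h, by ring⟩
    have hy : 1 < y := by linarith
    have hy2 : 1 ≤ y ^ 2 := one_le_pow₀ hy.le
    have hy3 : y ^ 2 ≤ y ^ 3 := pow_le_pow_right₀ hy.le (by norm_num)
    have hy1 : y ≤ y ^ 2 := by nlinarith
    rw [abs_le]
    constructor <;> nlinarith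

/-- Second-order expansion of the exponential of a quantity with a second-order expansion in `n`,
uniform in a size parameter `w`. -/
theorem abs_exp_sub_expansion_le {h n w a b C : ℝ} (hh : h ≤ 1) (hn0 : 0 ≤ n) (hn1 : n ≤ 1)
    (hw : 1 ≤ w) (ha : |a| ≤ w ^ 4) (hb : |b| ≤ w ^ 4) (hC : 1 ≤ C)
    (herr : |h - (a * n + b * n ^ 2)| ≤ C * w ^ 4 * n ^ 3) :
    |Real.exp h - (1 + a * n + (b + a ^ 2 / 2) * n ^ 2)| ≤ 86 * C ^ 3 * w ^ 12 * n ^ 3 := by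
  set W := w ^ 4 with hW
  have hW1 : 1 ≤ W := one_le_pow₀ hw
  have hw12 : w ^ 12 = W ^ 3 := by rw [hW]; ring
  rw [hw12]
  have hn2 : n ^ 2 ≤ n := by nlinarith
  have hn3 : n ^ 3 ≤ n ^ 2 := by nlinarith [sq_nonneg n]
  have hn20 := sq_nonneg n
  have hn30 : 0 ≤ n ^ 3 := by positivity
  have hWC : W ≤ C * W := by nlinarith
  have hWC1 : 1 ≤ C * W := by linarith
  have h1 : |h - a * n| ≤ 2 * (C * W) * n ^ 2 := by
    calc |h - a * n| = |(h - (a * n + b * n ^ 2)) + b * n ^ 2| := by ring_nf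
      _ ≤ C * W * n ^ 3 + |b| * n ^ 2 := by
        refine (abs_add_le _ _).trans (add_le_add herr (le_of_eq ?_))
        rw [abs_mul, abs_of_nonneg hn20]
      _ ≤ C * W * n ^ 2 + (C * W) * n ^ 2 := by gcongr; linarith
      _ = _ := by ring
  have han : |a * n| ≤ C * W * n := by
    rw [abs_mul, abs_of_nonneg hn0]
    gcongr
    linarith
  have h2 : |h| ≤ 3 * (C * W) * n := by
    calc |h| = |(h - a * n) + a * n| := by ring_nf
      _ ≤ 2 * (C * W) * n ^ 2 + C * W * n := (abs_add_le _ _).trans (add_le_add h1 han)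
      _ ≤ 2 * (C * W) * n + C * W * n := by gcongr
      _ = _ := by ring
  have h3 : |h + a * n| ≤ 4 * (C * W) * n := by
    refine (abs_add_le _ _).trans ((add_le_add h2 han).trans (le_of_eq ?_))
    ring
  have h4 : |h ^ 2 - (a * n) ^ 2| ≤ 8 * (C * W) ^ 3 * n ^ 3 := by
    calc |h ^ 2 - (a * n) ^ 2| = |h - a * n| * |h + a * n| := by rw [← abs_mul]; ring_nf
      _ ≤ (2 * (C * W) * n ^ 2) * (4 * (C * W) * n) := by gcongr
      _ = 8 * (C * W) ^ 2 * n ^ 3 := by ring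
      _ ≤ _ := by gcongr; norm_num
  have h5 : |h| ^ 3 ≤ 27 * (C * W) ^ 3 * n ^ 3 := by
    calc |h| ^ 3 ≤ (3 * (C * W) * n) ^ 3 := by gcongr
      _ = _ := by ring
  have h6 : C * W * n ^ 3 ≤ (C * W) ^ 3 * n ^ 3 := by
    gcongr
    exact le_self_pow₀ hWC1 (by norm_num)
  have h7 := abs_exp_sub_quadratic_le hh
  rw [show 86 * C ^ 3 * W ^ 3 * n ^ 3 = 86 * (C * W) ^ 3 * n ^ 3 by ring]
  rw [abs_le] at h7 h4 herr ⊢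
  constructor <;> nlinarith

theorem integrable_pow_mul_gaussian (k : ℕ) :
    MeasureTheory.Integrable fun s : ℝ => s ^ k * Real.exp (-(s ^ 2 / 2)) := by
  have h := integrable_rpow_mul_exp_neg_mul_sq (b := 1 / 2) (by norm_num) (s := k)
    (by linarith [Nat.cast_nonneg (α := ℝ) k])
  refine h.congr (Eventually.of_forall fun s => ?_)
  simp only [Real.rpow_natCast]
  ring_nf

theorem integral_pow_add_two_mul_gaussian (k : ℕ) :
    ∫ s : ℝ, s ^ (k + 2) * Real.exp (-(s ^ 2 / 2)) =
      (k + 1) * ∫ s : ℝ, s ^ k * Real.exp (-(s ^ 2 / 2)) := by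
  have hd : ∀ s : ℝ, HasDerivAt (fun s : ℝ => s ^ (k + 1) * Real.exp (-(s ^ 2 / 2)))
      ((k + 1) * (s ^ k * Real.exp (-(s ^ 2 / 2))) - s ^ (k + 2) * Real.exp (-(s ^ 2 / 2))) s := by
    intro s
    have h1 : HasDerivAt (fun s : ℝ => -(s ^ 2 / 2)) (-s) s := by
      have := ((hasDerivAt_pow 2 s).div_const 2).neg
      convert! this using 1
      simp
    convert! (hasDerivAt_pow (k + 1) s).mul h1.exp using 1
    push_cast
    ring_nf
  have hi1 := (integrable_pow_mul_gaussian k).const_mul ((k : ℝ) + 1)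
  have hi2 := integrable_pow_mul_gaussian (k + 2)
  have h := MeasureTheory.integral_eq_zero_of_hasDerivAt_of_integrable hd (hi1.sub hi2)
    (integrable_pow_mul_gaussian (k + 1))
  rw [MeasureTheory.integral_sub hi1 hi2, MeasureTheory.integral_const_mul] at h
  linarith

theorem integral_pow_zero_mul_gaussian :
    ∫ s : ℝ, s ^ 0 * Real.exp (-(s ^ 2 / 2)) = Real.sqrt (2 * Real.pi) := by
  have h := integral_gaussian (1 / 2)
  rw [show Real.pi / (1 / 2) = 2 * Real.pi by ring] at h
  rw [← h]
  congr 1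
  ext s
  ring_nf

/-- The second-order approximation, in `n = 1/N`, of the rescaled centred sum divided by the
Gaussian weight. -/
noncomputable def edgeworthPoly (n s : ℝ) : ℝ :=
  1 + -(s ^ 4 / 20) * n + ((s ^ 2 / 2 - s ^ 6 / 105) + (-(s ^ 4 / 20)) ^ 2 / 2) * n ^ 2

theorem edgeworthPoly_mul_gaussian (n s : ℝ) :
    edgeworthPoly n s * Real.exp (-(s ^ 2 / 2)) =
      s ^ 0 * Real.exp (-(s ^ 2 / 2)) + -n / 20 * (s ^ 4 * Real.exp (-(s ^ 2 / 2))) +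
      n ^ 2 / 2 * (s ^ 2 * Real.exp (-(s ^ 2 / 2))) +
      -n ^ 2 / 105 * (s ^ 6 * Real.exp (-(s ^ 2 / 2))) +
      n ^ 2 / 800 * (s ^ 8 * Real.exp (-(s ^ 2 / 2))) := by
  rw [edgeworthPoly]
  ring

theorem integrable_edgeworthPoly_mul_gaussian (n : ℝ) :
    MeasureTheory.Integrable fun s : ℝ => edgeworthPoly n s * Real.exp (-(s ^ 2 / 2)) := by
  simp_rw [edgeworthPoly_mul_gaussian]
  exact ((((integrable_pow_mul_gaussian 0).add ((integrable_pow_mul_gaussian 4).const_mul _)).add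
    ((integrable_pow_mul_gaussian 2).const_mul _)).add
    ((integrable_pow_mul_gaussian 6).const_mul _)).add
    ((integrable_pow_mul_gaussian 8).const_mul _)

theorem integral_edgeworthPoly_mul_gaussian (n : ℝ) :
    ∫ s : ℝ, edgeworthPoly n s * Real.exp (-(s ^ 2 / 2)) =
      Real.sqrt (2 * Real.pi) * (1 + -(3 / 20) * n + (1 / 2 - 1 / 7 + 21 / 160) * n ^ 2) := by
  simp_rw [edgeworthPoly_mul_gaussian]
  have i0 := integrable_pow_mul_gaussian 0
  have i4 := (integrable_pow_mul_gaussian 4).const_mul (-n / 20)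
  have i2 := (integrable_pow_mul_gaussian 2).const_mul (n ^ 2 / 2)
  have i6 := (integrable_pow_mul_gaussian 6).const_mul (-n ^ 2 / 105)
  have i8 := (integrable_pow_mul_gaussian 8).const_mul (n ^ 2 / 800)
  rw [MeasureTheory.integral_add ?_ i8, MeasureTheory.integral_add ?_ i6,
    MeasureTheory.integral_add ?_ i2, MeasureTheory.integral_add i0 i4]
  rotate_left
  · exact i0.add i4
  · exact (i0.add i4).add i2
  · exact ((i0.add i4).add i2).add i6
  simp only [MeasureTheory.integral_const_mul]
  have m2 := integral_pow_add_two_mul_gaussian 0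
  have m4 := integral_pow_add_two_mul_gaussian 2
  have m6 := integral_pow_add_two_mul_gaussian 4
  have m8 := integral_pow_add_two_mul_gaussian 6
  norm_num only [integral_pow_zero_mul_gaussian] at m2 m4 m6 m8 ⊢
  rw [m8, m6, m4, m2]
  ring

theorem integrable_one_add_sq_pow_mul_gaussian (m : ℕ) :
    MeasureTheory.Integrable fun s : ℝ => (1 + s ^ 2) ^ m * Real.exp (-(s ^ 2 / 2)) := by
  simp_rw [add_comm (1 : ℝ), add_pow, Finset.sum_mul]
  refine MeasureTheory.integrable_finsetSum _ fun i _ => ?_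
  refine ((integrable_pow_mul_gaussian (2 * i)).const_mul (m.choose i : ℝ)).congr
    (Eventually.of_forall fun s => ?_)
  simp only [one_pow, mul_one, pow_mul]
  ring

theorem log_stirlingSeq_sub_log_sqrt_pi_le {n : ℕ} (hn : 0 < n) :
    Real.log (Stirling.stirlingSeq n) - Real.log (Real.sqrt Real.pi) ≤ 1 / (12 * n) := by
  have hlim : Tendsto (fun m : ℕ => Real.log (Stirling.stirlingSeq (m + 1)) -
      1 / (12 * ((m : ℝ) + 1))) atTop (nhds (Real.log (Real.sqrt Real.pi) - 1 / 12 * 0)) := by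
    refine ((((tendsto_add_atTop_iff_nat 1).2 Stirling.tendsto_stirlingSeq_sqrt_pi).log
      (Real.sqrt_pos.2 Real.pi_pos).ne').sub
      ((tendsto_one_div_add_atTop_nhds_zero_nat (𝕜 := ℝ)).const_mul (1 / 12))).congr fun m => ?_
    congr 1
    field_simp
  have hmono : Monotone (fun m : ℕ => Real.log (Stirling.stirlingSeq (m + 1)) -
      1 / (12 * ((m : ℝ) + 1))) := by
    refine monotone_nat_of_le_succ fun m => ?_
    have h := Stirling.log_stirlingSeq_sdiff_le (m + 1)
    push_cast at h ⊢
    have e : 1 / (12 * ((m : ℝ) + 1)) - 1 / (12 * ((m : ℝ) + 1 + 1)) =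
        1 / (12 * ((m : ℝ) + 1) * (m + 1 + 1)) := by
      field_simp
      ring
    linarith
  obtain ⟨m, rfl⟩ := Nat.exists_eq_succ_of_ne_zero hn.ne'
  have h := hmono.ge_of_tendsto hlim m
  push_cast
  simp only [Nat.succ_eq_add_one, mul_zero, sub_zero] at h ⊢
  linarith

theorem le_log_stirlingSeq_sub_log_sqrt_pi {n : ℕ} (hn : 0 < n) :
    1 / (12 * (n : ℝ)) - 1 / (n : ℝ) ^ 3 ≤
      Real.log (Stirling.stirlingSeq n) - Real.log (Real.sqrt Real.pi) := by
  have hz := tendsto_one_div_add_atTop_nhds_zero_nat (𝕜 := ℝ)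
  have hlim : Tendsto (fun m : ℕ => Real.log (Stirling.stirlingSeq (m + 1)) -
      1 / (12 * ((m : ℝ) + 1)) + 1 / ((m : ℝ) + 1) ^ 3) atTop
      (nhds (Real.log (Real.sqrt Real.pi) - 1 / 12 * 0 + 0 ^ 3)) := by
    refine (((((tendsto_add_atTop_iff_nat 1).2 Stirling.tendsto_stirlingSeq_sqrt_pi).log
      (Real.sqrt_pos.2 Real.pi_pos).ne').sub (hz.const_mul (1 / 12))).add (hz.pow 3)).congr
      fun m => ?_
    field_simp
  have hanti : Antitone (fun m : ℕ => Real.log (Stirling.stirlingSeq (m + 1)) -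
      1 / (12 * ((m : ℝ) + 1)) + 1 / ((m : ℝ) + 1) ^ 3) := by
    refine antitone_nat_of_succ_le fun m => ?_
    have h := le_hasSum (Stirling.log_stirlingSeq_sdiff_hasSum m) 0 (fun k _ => by positivity)
    push_cast at h ⊢
    have hx : (1 : ℝ) ≤ (m : ℝ) + 1 := by linarith [Nat.cast_nonneg (α := ℝ) m]
    rw [show (m : ℕ) + 2 = m + 1 + 1 by rfl] at h
    generalize (m : ℝ) + 1 = x at h hx ⊢
    have e : 1 / (12 * x) - 1 / (12 * (x + 1)) - (1 / x ^ 3 - 1 / (x + 1) ^ 3) ≤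
        1 / 3 * (1 / (2 * x + 1)) ^ 2 := by
      have hx0 : 0 < x := by linarith
      rw [← sub_nonneg]
      have : 1 / 3 * (1 / (2 * x + 1)) ^ 2 -
          (1 / (12 * x) - 1 / (12 * (x + 1)) - (1 / x ^ 3 - 1 / (x + 1) ^ 3)) =
          (12 * (3 * x ^ 2 + 3 * x + 1) * (2 * x + 1) ^ 2 - (x ^ 2 + x) ^ 2) /
            (12 * x ^ 3 * (x + 1) ^ 3 * (2 * x + 1) ^ 2) := by
        field_simp
        ring
      rw [this]
      refine div_nonneg ?_ (by positivity)
      ring_nf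
      positivity
    norm_num at h
    rw [show (1 / (2 * x + 1)) ^ 2 = ((2 * x + 1) ^ 2)⁻¹ by rw [one_div, inv_pow]] at e
    linarith
  obtain ⟨m, rfl⟩ := Nat.exists_eq_succ_of_ne_zero hn.ne'
  have h := hanti.le_of_tendsto hlim m
  push_cast
  norm_num [Nat.succ_eq_add_one] at h ⊢
  linarith

theorem abs_sqrt_mul_div_factorial_sub_le {N : ℕ} (hN : 0 < N) :
    |Real.sqrt (2 * Real.pi * N) * (N / Real.exp 1) ^ N / N.factorial -
      (1 + -(1 / 12) * (N : ℝ)⁻¹ + 1 / 288 * (N : ℝ)⁻¹ ^ 2)| ≤ 86 * (N : ℝ)⁻¹ ^ 3 := by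
  have hpi := Real.pi_pos
  have hN1 : (1 : ℝ) ≤ N := by exact_mod_cast hN
  have hs : 0 < Stirling.stirlingSeq N := by
    obtain ⟨m, rfl⟩ := Nat.exists_eq_succ_of_ne_zero hN.ne'
    exact Stirling.stirlingSeq'_pos m
  have hX : Real.sqrt (2 * Real.pi * N) * (N / Real.exp 1) ^ N / N.factorial =
      Real.exp (-(Real.log (Stirling.stirlingSeq N) - Real.log (Real.sqrt Real.pi))) := by
    rw [neg_sub, Real.exp_sub, Real.exp_log (Real.sqrt_pos.2 hpi), Real.exp_log hs,
      Stirling.stirlingSeq, show 2 * Real.pi * (N : ℝ) = Real.pi * (2 * N) by ring,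
      Real.sqrt_mul hpi.le]
    field_simp
  have hle : Real.log (Real.sqrt Real.pi) ≤ Real.log (Stirling.stirlingSeq N) :=
    Real.log_le_log (Real.sqrt_pos.2 hpi) (Stirling.sqrt_pi_le_stirlingSeq hN.ne')
  have hu := log_stirlingSeq_sub_log_sqrt_pi_le hN
  have hl := le_log_stirlingSeq_sub_log_sqrt_pi hN
  have e1 : 1 / (12 * (N : ℝ)) = 1 / 12 * (N : ℝ)⁻¹ := by field_simp
  have e3 : 1 / (N : ℝ) ^ 3 = (N : ℝ)⁻¹ ^ 3 := by field_simp
  rw [e1] at hu hl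
  rw [e3] at hl
  have hn0 : 0 ≤ (N : ℝ)⁻¹ := by positivity
  have hn3 : 0 ≤ (N : ℝ)⁻¹ ^ 3 := by positivity
  have h := abs_exp_sub_expansion_le (w := 1) (a := -(1 / 12)) (b := 0) (C := 1)
    (h := -(Real.log (Stirling.stirlingSeq N) - Real.log (Real.sqrt Real.pi)))
    (by linarith) hn0 (inv_le_one_of_one_le₀ hN1) le_rfl (by norm_num [abs_le]) (by norm_num)
    le_rfl (by rw [abs_le]; constructor <;> linarith)
  rw [hX]
  norm_num at h ⊢
  exact h

theorem abs_prod_one_sub_sub_le {N : ℕ} (hN : 2 ≤ N) :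
    |∏ i ∈ Finset.range N, (1 - (i : ℝ) / (N : ℝ) ^ 3) -
      (1 + -(1 / 2) * (N : ℝ)⁻¹ + 5 / 8 * (N : ℝ)⁻¹ ^ 2)| ≤ 688 * (N : ℝ)⁻¹ ^ 3 := by
  have hN1 : (2 : ℝ) ≤ N := by exact_mod_cast hN
  have hmem : ∀ i ∈ Finset.range N, 0 ≤ (i : ℝ) / (N : ℝ) ^ 3 ∧
      (i : ℝ) / (N : ℝ) ^ 3 ≤ 1 / 2 ∧ (i : ℝ) / (N : ℝ) ^ 3 ≤ 1 / (N : ℝ) ^ 2 := by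
    intro i hi
    obtain ⟨h0, h1, -⟩ := cast_div_cube_bounds hi
    rw [add_div] at h1
    have h3 : 0 ≤ 1 / (N : ℝ) ^ 3 := by positivity
    have h4 : 1 / (N : ℝ) ^ 2 ≤ 1 / 2 ^ 2 := by gcongr
    exact ⟨h0, by linarith, by linarith⟩
  have hlog : ∀ i ∈ Finset.range N, |Real.log (1 - (i : ℝ) / (N : ℝ) ^ 3) +
      (i : ℝ) / (N : ℝ) ^ 3| ≤ 2 * (1 / (N : ℝ) ^ 2) ^ 2 := by
    intro i hi
    obtain ⟨h0, h1, h2⟩ := hmem i hi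
    have h := abs_le.1 (abs_log_one_sub_add_le h0 h1)
    generalize (i : ℝ) / (N : ℝ) ^ 3 = e at *
    have hm : e ^ 2 ≤ (1 / (N : ℝ) ^ 2) ^ 2 := by gcongr
    have e3 : e ^ 3 ≤ e ^ 2 / 2 := by nlinarith [sq_nonneg e]
    have e30 : 0 ≤ e ^ 3 := by positivity
    have e4 : e ^ 4 ≤ e ^ 3 / 2 := by nlinarith
    rw [abs_le]
    constructor <;> linarith [sq_nonneg e]
  have hA : ∏ i ∈ Finset.range N, (1 - (i : ℝ) / (N : ℝ) ^ 3) =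
      Real.exp (∑ i ∈ Finset.range N, Real.log (1 - (i : ℝ) / (N : ℝ) ^ 3)) := by
    rw [Real.exp_sum]
    refine Finset.prod_congr rfl fun i hi => ?_
    obtain ⟨h0, h1, h2⟩ := hmem i hi
    rw [Real.exp_log (by linarith)]
  have hsum := (Finset.abs_sum_le_sum_abs _ _).trans (Finset.sum_le_sum hlog)
  rw [Finset.sum_add_distrib, sum_range_cast_div_cube (by omega), Finset.sum_const,
    Finset.card_range, nsmul_eq_mul] at hsum
  have e1 : 1 / (2 * (N : ℝ)) - 1 / (2 * (N : ℝ) ^ 2) =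
    1 / 2 * (N : ℝ)⁻¹ - 1 / 2 * (N : ℝ)⁻¹ ^ 2 := by field_simp
  have e3 : N * (2 * (1 / (N : ℝ) ^ 2) ^ 2) = 2 * (N : ℝ)⁻¹ ^ 3 := by field_simp
  rw [e1, e3] at hsum
  have hn0 : 0 ≤ (N : ℝ)⁻¹ := by positivity
  have hn1 : (N : ℝ)⁻¹ ≤ 1 / 2 := by
    rw [inv_eq_one_div]
    gcongr
  have hn2 : (N : ℝ)⁻¹ ^ 2 ≤ (1 / 2) ^ 2 := by gcongr
  have hn3 : (N : ℝ)⁻¹ ^ 3 ≤ (1 / 2) ^ 3 := by gcongr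
  rw [hA]
  have h := abs_exp_sub_expansion_le (w := 1) (a := -(1 / 2)) (b := 1 / 2) (C := 2)
    (h := ∑ i ∈ Finset.range N, Real.log (1 - (i : ℝ) / (N : ℝ) ^ 3))
    (by linarith [(abs_le.1 hsum).2]) hn0 (by linarith) le_rfl (by norm_num [abs_le])
    (by norm_num [abs_le]) (by norm_num) (by
      refine le_trans (le_of_eq ?_) (hsum.trans (by linarith))
      congr 1
      ring)
  norm_num at h ⊢
  exact h

theorem expansion_mul {f g : ℕ → ℝ} {a₁ a₂ b₁ b₂ : ℝ}
    (hf : (fun N => f N - (1 + a₁ * (N : ℝ)⁻¹ + a₂ * (N : ℝ)⁻¹ ^ 2)) =O[atTop]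
      fun N : ℕ => (N : ℝ)⁻¹ ^ 3)
    (hg : (fun N => g N - (1 + b₁ * (N : ℝ)⁻¹ + b₂ * (N : ℝ)⁻¹ ^ 2)) =O[atTop]
      fun N : ℕ => (N : ℝ)⁻¹ ^ 3) :
    (fun N => f N * g N -
      (1 + (a₁ + b₁) * (N : ℝ)⁻¹ + (a₂ + a₁ * b₁ + b₂) * (N : ℝ)⁻¹ ^ 2)) =O[atTop]
      fun N : ℕ => (N : ℝ)⁻¹ ^ 3 := by
  have hn : Tendsto (fun N : ℕ => (N : ℝ)⁻¹) atTop (nhds 0) := tendsto_inv_atTop_nhds_zero_nat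
  have hpoly : ∀ c₀ c₁ c₂ : ℝ, (fun N : ℕ => c₀ + c₁ * (N : ℝ)⁻¹ + c₂ * (N : ℝ)⁻¹ ^ 2) =O[atTop]
      fun _ : ℕ => (1 : ℝ) := fun c₀ c₁ c₂ =>
    ((tendsto_const_nhds.add (hn.const_mul c₁)).add ((hn.pow 2).const_mul c₂)).isBigO_one ℝ
  have hf1 : f =O[atTop] fun _ : ℕ => (1 : ℝ) := by
    have := (hf.trans ((hn.pow 3).isBigO_one ℝ)).add (hpoly 1 a₁ a₂)
    simpa using this
  have h1 := hf1.mul hg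
  have h2 := (hpoly 1 b₁ b₂).mul hf
  have h3 := (hpoly (a₁ * b₂ + a₂ * b₁) (a₂ * b₂) 0).mul
    (isBigO_refl (fun N : ℕ => (N : ℝ)⁻¹ ^ 3) atTop)
  simp only [one_mul] at h1 h2 h3
  refine ((h1.add h2).add h3).congr_left fun N => ?_
  ring

theorem continuousOn_logSincRatio (N : ℕ) :
    ContinuousOn (logSincRatio N) (Set.Icc (-2) 2) := by
  have key : ∀ e : ℝ, 0 ≤ e → e ≤ 1 →
      ContinuousOn (fun u => Real.log (Real.sinc (e * u))) (Set.Icc (-2) 2) := by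
    intro e h0 h1
    refine ContinuousOn.log (Real.continuous_sinc.comp (continuous_const_mul e)).continuousOn
      fun u hu => ?_
    exact (sinc_pos_of_abs_le_two (abs_mul_le_two_of_mem h0 h1 (abs_le.2 hu))).ne'
  unfold logSincRatio
  refine continuousOn_finsetSum _ fun i hi => ?_
  obtain ⟨h0, h1, h2⟩ := cast_div_cube_bounds hi
  have h3 : (i : ℝ) / (N : ℝ) ^ 3 ≤ (i + 1) / (N : ℝ) ^ 3 := by gcongr; linarith
  exact (key _ (by linarith) (by linarith)).sub (key _ (by linarith) (by linarith))

theorem abs_exp_logSincRatio_sub_le {N : ℕ} (hN : 10 ≤ N) {s u : ℝ}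
    (hsu : N * u ^ 2 = 3 * s ^ 2) (hu : |u| ≤ 2) :
    |Real.exp (logSincRatio N u) - edgeworthPoly (N : ℝ)⁻¹ s * Real.exp (-(s ^ 2 / 2))| ≤
      86 * 300 ^ 3 * (N : ℝ)⁻¹ ^ 3 * ((1 + s ^ 2) ^ 12 * Real.exp (-(s ^ 2 / 2))) := by
  have hN0 : 0 < N := by omega
  have hN1 : (1 : ℝ) ≤ N := by exact_mod_cast hN0
  have hn0 : 0 ≤ (N : ℝ)⁻¹ := by positivity
  have hn1 : (N : ℝ)⁻¹ ≤ 1 := inv_le_one_of_one_le₀ hN1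
  have hle := logSincRatio_add_le_one hN hu
  have herr := abs_logSincRatio_add_le hN0 hu
  have hu2 : u ^ 2 = 3 * s ^ 2 * (N : ℝ)⁻¹ := by
    field_simp
    linarith
  have e1 : (N : ℝ) * u ^ 2 / 6 = s ^ 2 / 2 := by rw [hsu]; ring
  have e2 : u ^ 2 / (6 * N) - N * u ^ 4 / 180 - N * u ^ 6 / 2835 =
      -(s ^ 4 / 20) * (N : ℝ)⁻¹ + (s ^ 2 / 2 - s ^ 6 / 105) * (N : ℝ)⁻¹ ^ 2 := by
    rw [show u ^ 4 = (u ^ 2) ^ 2 by ring, show u ^ 6 = (u ^ 2) ^ 3 by ring, hu2]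
    field_simp
    ring
  have e3 : (N : ℝ) * u ^ 8 + 68 * (u ^ 2 / (N : ℝ) ^ 2) + u ^ 4 / N =
      (81 * s ^ 8 + 204 * s ^ 2 + 9 * s ^ 4) * (N : ℝ)⁻¹ ^ 3 := by
    rw [show u ^ 8 = (u ^ 2) ^ 4 by ring, show u ^ 4 = (u ^ 2) ^ 2 by ring, hu2]
    field_simp
    ring
  rw [e1] at hle
  rw [e1, e2, e3] at herr
  have hs2 : 0 ≤ s ^ 2 := sq_nonneg s
  have hs4 : 0 ≤ s ^ 4 := by positivity
  have hs6 : 0 ≤ s ^ 6 := by positivity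
  have hs8 : 0 ≤ s ^ 8 := by positivity
  have hw : (1 + s ^ 2) ^ 4 = 1 + 4 * s ^ 2 + 6 * s ^ 4 + 4 * s ^ 6 + s ^ 8 := by ring
  have h := abs_exp_sub_expansion_le (w := 1 + s ^ 2) (C := 300) hle hn0 hn1 (by linarith)
    (a := -(s ^ 4 / 20)) (b := s ^ 2 / 2 - s ^ 6 / 105)
    (by rw [abs_le, hw]; constructor <;> linarith) (by rw [abs_le, hw]; constructor <;> linarith)
    (by norm_num)
    (herr.trans (mul_le_mul_of_nonneg_right (by rw [hw]; linarith) (by positivity)))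
  have hexp : Real.exp (logSincRatio N u) =
      Real.exp (logSincRatio N u + s ^ 2 / 2) * Real.exp (-(s ^ 2 / 2)) := by
    rw [← Real.exp_add]
    ring_nf
  rw [hexp, ← sub_mul, abs_mul, Real.abs_exp]
  calc _ ≤ 86 * 300 ^ 3 * (1 + s ^ 2) ^ 12 * (N : ℝ)⁻¹ ^ 3 * Real.exp (-(s ^ 2 / 2)) :=
        mul_le_mul_of_nonneg_right h (Real.exp_pos _).le
    _ = _ := by ring

theorem abs_edgeworthPoly_le {n s : ℝ} (hn0 : 0 ≤ n) (hn1 : n ≤ 1) (hs : 1 ≤ n * s ^ 2) :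
    |edgeworthPoly n s| ≤ 86 * 300 ^ 3 * n ^ 3 * (1 + s ^ 2) ^ 12 := by
  have hs2 : 0 ≤ s ^ 2 := sq_nonneg s
  have hs4 : 0 ≤ s ^ 4 := by positivity
  have hs6 : 0 ≤ s ^ 6 := by positivity
  have hs8 : 0 ≤ s ^ 8 := by positivity
  have hw : (1 + s ^ 2) ^ 4 = 1 + 4 * s ^ 2 + 6 * s ^ 4 + 4 * s ^ 6 + s ^ 8 := by ring
  have hn2 : n ^ 2 ≤ 1 := pow_le_one₀ hn0 hn1
  have hn2' : 0 ≤ n ^ 2 := by positivity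
  have hpoly : |edgeworthPoly n s| ≤ 4 * (1 + s ^ 2) ^ 4 := by
    have m1 := mul_le_of_le_one_right hs4 hn1
    have m2 := mul_le_of_le_one_right hs2 hn2
    have m3 := mul_le_of_le_one_right hs6 hn2
    have m4 := mul_le_of_le_one_right hs8 hn2
    have p1 := mul_nonneg hs4 hn0
    have p2 := mul_nonneg hs2 hn2'
    have p3 := mul_nonneg hs6 hn2'
    have p4 := mul_nonneg hs8 hn2'
    have e : edgeworthPoly n s = 1 - s ^ 4 * n / 20 + s ^ 2 * n ^ 2 / 2 - s ^ 6 * n ^ 2 / 105 +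
        s ^ 8 * n ^ 2 / 800 := by
      rw [edgeworthPoly]
      ring
    rw [e, hw, abs_le]
    constructor <;> linarith
  have h1 : (1 : ℝ) ≤ 1 + s ^ 2 := by linarith
  have h3 : 1 ≤ (n * (1 + s ^ 2)) ^ 3 := one_le_pow₀ (by linarith)
  have h4 : (1 + s ^ 2) ^ 4 ≤ (1 + s ^ 2) ^ 9 := pow_le_pow_right₀ h1 (by norm_num)
  have h9 : (1 + s ^ 2) ^ 9 ≤ n ^ 3 * (1 + s ^ 2) ^ 12 := by
    calc (1 + s ^ 2) ^ 9 ≤ (n * (1 + s ^ 2)) ^ 3 * (1 + s ^ 2) ^ 9 :=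
          le_mul_of_one_le_left (by positivity) h3
      _ = _ := by ring
  have h12 : 0 ≤ n ^ 3 * (1 + s ^ 2) ^ 12 := by positivity
  linarith

theorem abs_integral_exp_logSincRatio_sub_le {N : ℕ} (hN : 10 ≤ N) {c : ℝ} (hc : 0 < c)
    (hNc : N * c ^ 2 = 3) :
    |(∫ s in -(2 / c)..2 / c, Real.exp (logSincRatio N (c * s))) -
        ∫ s : ℝ, edgeworthPoly (N : ℝ)⁻¹ s * Real.exp (-(s ^ 2 / 2))| ≤
      86 * 300 ^ 3 * (N : ℝ)⁻¹ ^ 3 *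
        ∫ s : ℝ, (1 + s ^ 2) ^ 12 * Real.exp (-(s ^ 2 / 2)) := by
  have hN1 : (1 : ℝ) ≤ N := by exact_mod_cast (by omega : 1 ≤ N)
  have hmem : ∀ s, s ∈ Set.Icc (-(2 / c)) (2 / c) → |c * s| ≤ 2 := by
    intro s hs
    rw [abs_mul, abs_of_pos hc]
    have := abs_le.2 hs
    rw [le_div_iff₀ hc] at this
    linarith
  have hcont : ContinuousOn (fun s => Real.exp (logSincRatio N (c * s)))
      (Set.Icc (-(2 / c)) (2 / c)) :=
    ((continuousOn_logSincRatio N).comp (continuous_const_mul c).continuousOn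
      fun s hs => abs_le.1 (hmem s hs)).rexp
  have hint : MeasureTheory.Integrable
      ((Set.Ioc (-(2 / c)) (2 / c)).indicator fun s => Real.exp (logSincRatio N (c * s))) :=
    (MeasureTheory.integrable_indicator_iff measurableSet_Ioc).2
      ((hcont.integrableOn_Icc).mono_set Set.Ioc_subset_Icc_self)
  rw [intervalIntegral.integral_of_le (by have : 0 < 2 / c := by positivity
                                          linarith),
    ← MeasureTheory.integral_indicator measurableSet_Ioc,
    ← MeasureTheory.integral_sub hint (integrable_edgeworthPoly_mul_gaussian _),
    ← MeasureTheory.integral_const_mul]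
  rw [← Real.norm_eq_abs]
  refine MeasureTheory.norm_integral_le_of_norm_le
    ((integrable_one_add_sq_pow_mul_gaussian 12).const_mul _) (Eventually.of_forall fun s => ?_)
  have hsu : N * (c * s) ^ 2 = 3 * s ^ 2 := by rw [mul_pow, ← mul_assoc, hNc]
  rw [Real.norm_eq_abs]
  by_cases hs : s ∈ Set.Ioc (-(2 / c)) (2 / c)
  · rw [Set.indicator_of_mem hs]
    exact abs_exp_logSincRatio_sub_le hN hsu (hmem s (Set.Ioc_subset_Icc_self hs))
  · rw [Set.indicator_of_notMem hs, zero_sub, abs_neg, abs_mul, Real.abs_exp, ← mul_assoc]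
    refine mul_le_mul_of_nonneg_right
      (abs_edgeworthPoly_le (by positivity) (inv_le_one_of_one_le₀ hN1) ?_) (Real.exp_pos _).le
    have habs : 2 ≤ |c * s| := by
      rw [abs_mul, abs_of_pos hc]
      by_contra! hlt
      have hlt' : |s| < 2 / c := by
        rw [lt_div_iff₀ hc]
        linarith
      exact hs ⟨(abs_lt.1 hlt').1, (abs_lt.1 hlt').2.le⟩
    have h4 : 4 ≤ (c * s) ^ 2 := by
      rw [← sq_abs]
      nlinarith
    rw [inv_mul_eq_div, le_div_iff₀ (by linarith)]
    nlinarith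

theorem integral_centeredCosSum_central {N : ℕ} (hN : 0 < N) {c : ℝ} (hc : 0 < c) :
    ∫ t in -(4 / (N : ℝ) ^ 3)..4 / (N : ℝ) ^ 3, centeredCosSum (N ^ 3) N t =
      2 * c / (N : ℝ) ^ 3 * (((N : ℝ) ^ 3) ^ N / N.factorial *
        (∏ i ∈ Finset.range N, (1 - (i : ℝ) / (N : ℝ) ^ 3)) *
        ∫ s in -(2 / c)..2 / c, Real.exp (logSincRatio N (c * s))) := by
  have hN0 : (N : ℝ) ≠ 0 := by exact_mod_cast hN.ne'
  have e : 2 * c / (N : ℝ) ^ 3 * (2 / c) = 4 / (N : ℝ) ^ 3 := by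
    field_simp
    norm_num
  rw [← e, ← mul_neg, ← intervalIntegral.mul_integral_comp_mul_left]
  congr 1
  rw [← intervalIntegral.integral_const_mul]
  refine intervalIntegral.integral_congr_ae ?_
  filter_upwards [MeasureTheory.Measure.ae_ne MeasureTheory.volume (0 : ℝ)] with s hs0 hs
  have h2c : 0 < 2 / c := by positivity
  rw [Set.uIoc_of_le (by linarith)] at hs
  have hu : |c * s| ≤ 2 := by
    rw [abs_mul, abs_of_pos hc]
    have := abs_le.2 ⟨hs.1.le, hs.2⟩
    rw [le_div_iff₀ hc] at this
    linarith
  rw [← centeredCosSum_eq_exp hu (mul_ne_zero hc.ne' hs0)]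
  congr 1
  ring

theorem abs_centeredCosSum_le_of_le_abs {N : ℕ} (hN : 0 < N) {t : ℝ}
    (ht : 4 / (N : ℝ) ^ 3 ≤ |t|) (htpi : |t| ≤ Real.pi) :
    |centeredCosSum (N ^ 3) N t| ≤
      ((N : ℝ) ^ 2) ^ N * Real.exp (N * (Real.pi / 4) + 1) := by
  have hN1 : (1 : ℝ) ≤ N := by exact_mod_cast hN
  have hN0 : (0 : ℝ) < N := by linarith
  have hpi := Real.pi_pos
  have hpos : 0 < 4 / (N : ℝ) ^ 3 := by positivity
  have ht0 : t ≠ 0 := abs_pos.1 (hpos.trans_le ht)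
  have hsum := norm_sum_Icc_exp_le (M := N ^ 3) ht0 htpi
  have h := abs_centeredCosSum_le (N ^ 3) N t (r := 1 / (N : ℝ) ^ 2) (by positivity)
  have hle : 1 / (N : ℝ) ^ 2 *
      ‖∑ a ∈ Finset.Icc 1 (N ^ 3), Complex.exp (t * Complex.I) ^ a‖ ≤ N * (Real.pi / 4) := by
    calc _ ≤ 1 / (N : ℝ) ^ 2 * (Real.pi / (4 / (N : ℝ) ^ 3)) :=
          mul_le_mul_of_nonneg_left (hsum.trans (by gcongr)) (by positivity)
      _ = N * (Real.pi / 4) := by field_simp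
  have hle2 : ((N ^ 3 : ℕ) : ℝ) * (1 / (N : ℝ) ^ 2) ^ 2 / 2 ≤ 1 := by
    have e : ((N ^ 3 : ℕ) : ℝ) * (1 / (N : ℝ) ^ 2) ^ 2 / 2 = 1 / (2 * N) := by
      push_cast
      field_simp
    rw [e, div_le_one (by positivity)]
    linarith
  have h2 := h.trans (Real.exp_le_exp.2 (add_le_add hle hle2))
  rw [one_div, inv_pow, ← div_eq_mul_inv, div_le_iff₀ (by positivity)] at h2
  linarith

theorem abs_integral_centeredCosSum_sub_le {N : ℕ} (hN : 2 ≤ N) :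
    |(∫ t in -Real.pi..Real.pi, centeredCosSum (N ^ 3) N t) -
        ∫ t in -(4 / (N : ℝ) ^ 3)..4 / (N : ℝ) ^ 3, centeredCosSum (N ^ 3) N t| ≤
      2 * Real.pi * (((N : ℝ) ^ 2) ^ N * Real.exp (N * (Real.pi / 4) + 1)) := by
  have hN2 : (2 : ℝ) ≤ N := by exact_mod_cast hN
  have hpi := Real.pi_gt_three
  have hi : ∀ a b, IntervalIntegrable (centeredCosSum (N ^ 3) N) MeasureTheory.volume a b :=
    fun a b => (continuous_centeredCosSum _ _).intervalIntegrable a b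
  have hd0 : 0 < 4 / (N : ℝ) ^ 3 := by positivity
  have hd1 : 4 / (N : ℝ) ^ 3 ≤ 1 := by
    rw [div_le_one (by positivity)]
    calc (4 : ℝ) ≤ 2 ^ 3 := by norm_num
      _ ≤ (N : ℝ) ^ 3 := by gcongr
  have hB : 0 ≤ ((N : ℝ) ^ 2) ^ N * Real.exp (N * (Real.pi / 4) + 1) := by positivity
  have hbound := fun {t : ℝ} => abs_centeredCosSum_le_of_le_abs (N := N) (t := t) (by omega)
  generalize ((N : ℝ) ^ 2) ^ N * Real.exp (N * (Real.pi / 4) + 1) = B at *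
  generalize 4 / (N : ℝ) ^ 3 = d at *
  have hsplit : (∫ t in -Real.pi..Real.pi, centeredCosSum (N ^ 3) N t) -
      ∫ t in -d..d, centeredCosSum (N ^ 3) N t =
      (∫ t in -Real.pi..-d, centeredCosSum (N ^ 3) N t) +
        ∫ t in d..Real.pi, centeredCosSum (N ^ 3) N t := by
    rw [← intervalIntegral.integral_add_adjacent_intervals (hi (-Real.pi) (-d)) (hi (-d) Real.pi),
      ← intervalIntegral.integral_add_adjacent_intervals (hi (-d) d) (hi d Real.pi)]
    ring
  have h1 : |∫ t in -Real.pi..-d, centeredCosSum (N ^ 3) N t| ≤ B * |-d - -Real.pi| := by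
    rw [← Real.norm_eq_abs]
    refine intervalIntegral.norm_integral_le_of_norm_le_const fun t ht => ?_
    rw [Set.uIoc_of_le (by linarith)] at ht
    have ht2 := ht.2
    have hneg : |t| = -t := abs_of_nonpos (by linarith)
    exact hbound (by rw [hneg]; linarith) (by rw [hneg]; linarith [ht.1])
  have h2 : |∫ t in d..Real.pi, centeredCosSum (N ^ 3) N t| ≤ B * |Real.pi - d| := by
    rw [← Real.norm_eq_abs]
    refine intervalIntegral.norm_integral_le_of_norm_le_const fun t ht => ?_
    rw [Set.uIoc_of_le (by linarith)] at ht
    have hab : |t| = t := abs_of_nonneg (by linarith [ht.1])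
    exact hbound (by rw [hab]; linarith [ht.1]) (by rw [hab]; linarith [ht.2])
  rw [abs_of_nonneg (a := -d - -Real.pi) (by linarith)] at h1
  rw [abs_of_nonneg (a := Real.pi - d) (by linarith)] at h2
  rw [hsplit]
  refine (abs_add_le _ _).trans ?_
  nlinarith

theorem pow_four_mul_exp_neg_le {a x : ℝ} (ha : 0 < a) (hx : 0 < x) :
    x ^ 4 * Real.exp (-(a * x)) ≤ (Nat.factorial 7 : ℝ) / a ^ 7 * x⁻¹ ^ 3 := by
  have h := Real.pow_div_factorial_le_exp (a * x) (by positivity) 7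
  rw [div_le_iff₀ (by positivity)] at h
  rw [Real.exp_neg, div_mul_eq_mul_div, le_div_iff₀ (by positivity)]
  have he := Real.exp_pos (a * x)
  rw [← div_eq_mul_inv, div_mul_eq_mul_div, div_le_iff₀ he, inv_pow, mul_right_comm,
    ← div_eq_mul_inv, le_div_iff₀ (by positivity)]
  calc x ^ 4 * a ^ 7 * x ^ 3 = (a * x) ^ 7 := by ring
    _ ≤ _ := h
    _ = _ := by ring

theorem abs_normalized_magicCubeSeries_sub_le {N : ℕ} (hN : 10 ≤ N) :
    |Real.pi / Real.sqrt 3 * (N : ℝ) ^ 4 * (((N : ℝ) ^ 2 * Real.exp 1) ^ N)⁻¹ *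
          (magicCubeSeries N : ℝ) -
        Real.sqrt (2 * Real.pi * N) * (N / Real.exp 1) ^ N / N.factorial *
          (∏ i ∈ Finset.range N, (1 - (i : ℝ) / (N : ℝ) ^ 3)) *
          ((∫ s in -(2 / (Real.sqrt 3 / Real.sqrt N))..2 / (Real.sqrt 3 / Real.sqrt N),
            Real.exp (logSincRatio N (Real.sqrt 3 / Real.sqrt N * s))) /
              Real.sqrt (2 * Real.pi))| ≤
      Real.pi / Real.sqrt 3 * Real.exp 1 *
        ((Nat.factorial 7 : ℝ) / (1 - Real.pi / 4) ^ 7) * (N : ℝ)⁻¹ ^ 3 := by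
  have hpi := Real.pi_pos
  have hN0 : (0 : ℝ) < N := by exact_mod_cast (by omega : 0 < N)
  have hs3 : 0 < Real.sqrt 3 := Real.sqrt_pos.2 (by norm_num)
  have hsN : 0 < Real.sqrt N := Real.sqrt_pos.2 hN0
  have hsN2 : Real.sqrt N ^ 2 = N := Real.sq_sqrt hN0.le
  have hcentral := integral_centeredCosSum_central (N := N) (by omega) (div_pos hs3 hsN)
  have htail := abs_integral_centeredCosSum_sub_le (N := N) (by omega)
  rw [hcentral] at htail
  rw [magicCubeSeries_eq_integral, Real.sqrt_mul (by positivity) (N : ℝ)]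
  have h2pi : 0 < Real.sqrt (2 * Real.pi) := Real.sqrt_pos.2 (by positivity)
  generalize (∫ t in -Real.pi..Real.pi, centeredCosSum (N ^ 3) N t) = I at *
  generalize (∫ s in -(2 / (Real.sqrt 3 / Real.sqrt N))..2 / (Real.sqrt 3 / Real.sqrt N),
    Real.exp (logSincRatio N (Real.sqrt 3 / Real.sqrt N * s))) = J at *
  generalize (∏ i ∈ Finset.range N, (1 - (i : ℝ) / (N : ℝ) ^ 3)) = A at *
  set P : ℝ := Real.pi / Real.sqrt 3 * (N : ℝ) ^ 4 * (((N : ℝ) ^ 2 * Real.exp 1) ^ N)⁻¹ *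
    (2 * Real.pi)⁻¹ with hP
  have hP0 : 0 ≤ P := by positivity
  have hmain : Real.sqrt (2 * Real.pi) * Real.sqrt N * (N / Real.exp 1) ^ N / N.factorial * A *
      (J / Real.sqrt (2 * Real.pi)) = P * (2 * (Real.sqrt 3 / Real.sqrt N) / (N : ℝ) ^ 3 *
        (((N : ℝ) ^ 3) ^ N / N.factorial * A * J)) := by
    have e : ((N : ℝ) ^ 3) ^ N = ((N : ℝ) ^ 2) ^ N * (N : ℝ) ^ N := by
      rw [← mul_pow]
      ring_nf
    rw [hP, e, div_pow, mul_pow]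
    field_simp
    rw [hsN2]
    ring
  have hdecay := pow_four_mul_exp_neg_le (a := 1 - Real.pi / 4) (by linarith [Real.pi_lt_four]) hN0
  have hexp : P * (2 * Real.pi * (((N : ℝ) ^ 2) ^ N * Real.exp (N * (Real.pi / 4) + 1))) =
      Real.pi / Real.sqrt 3 * Real.exp 1 *
        ((N : ℝ) ^ 4 * Real.exp (-((1 - Real.pi / 4) * N))) := by
    have e : Real.exp (-((1 - Real.pi / 4) * N)) =
        Real.exp (N * (Real.pi / 4)) / Real.exp 1 ^ N := by
      rw [← Real.exp_nat_mul, ← Real.exp_sub]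
      ring_nf
    rw [hP, e, Real.exp_add, mul_pow]
    field_simp
  calc _ = |P * (I - 2 * (Real.sqrt 3 / Real.sqrt N) / (N : ℝ) ^ 3 *
        (((N : ℝ) ^ 3) ^ N / N.factorial * A * J))| := by
        rw [hmain]
        congr 1
        rw [hP]
        ring
    _ ≤ P * (2 * Real.pi * (((N : ℝ) ^ 2) ^ N * Real.exp (N * (Real.pi / 4) + 1))) := by
        rw [abs_mul, abs_of_nonneg hP0]
        exact mul_le_mul_of_nonneg_left htail hP0
    _ ≤ Real.pi / Real.sqrt 3 * Real.exp 1 *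
        ((Nat.factorial 7 : ℝ) / (1 - Real.pi / 4) ^ 7 * (N : ℝ)⁻¹ ^ 3) := by
        rw [hexp]
        exact mul_le_mul_of_nonneg_left hdecay (by positivity)
    _ = _ := by ring

/-- Second-order asymptotic expansion for the number of magic cube series:
`𝒩₃(N) = (√3/π) (N²e)^N / N⁴ (1 - 11/(15N) + 157/(126N²) + O(1/N³))`, stated as
`(π/√3) N⁴ (N²e)^{-N} 𝒩₃(N) - (1 - 11/(15N) + 157/(126N²)) = O(1/N³)`. -/
theorem magic_cube_series_asymptotics :
    (fun N : ℕ =>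
        Real.pi / Real.sqrt 3 * (N : ℝ) ^ 4 *
            (((N : ℝ) ^ 2 * Real.exp 1) ^ N)⁻¹ * (magicCubeSeries N : ℝ) -
          (1 - 11 / (15 * (N : ℝ)) + 157 / (126 * (N : ℝ) ^ 2)))
      =O[atTop] fun N : ℕ => 1 / (N : ℝ) ^ 3 := by
  have h10 : ∀ᶠ N : ℕ in atTop, 10 ≤ N := eventually_ge_atTop 10
  have hX : (fun N : ℕ => Real.sqrt (2 * Real.pi * N) * (N / Real.exp 1) ^ N / N.factorial -
      (1 + -(1 / 12) * (N : ℝ)⁻¹ + 1 / 288 * (N : ℝ)⁻¹ ^ 2)) =O[atTop]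
      fun N : ℕ => (N : ℝ)⁻¹ ^ 3 := by
    refine IsBigO.of_bound 86 (h10.mono fun N hN => ?_)
    rw [Real.norm_eq_abs, Real.norm_of_nonneg (by positivity)]
    exact abs_sqrt_mul_div_factorial_sub_le (by omega)
  have hA : (fun N : ℕ => ∏ i ∈ Finset.range N, (1 - (i : ℝ) / (N : ℝ) ^ 3) -
      (1 + -(1 / 2) * (N : ℝ)⁻¹ + 5 / 8 * (N : ℝ)⁻¹ ^ 2)) =O[atTop]
      fun N : ℕ => (N : ℝ)⁻¹ ^ 3 := by
    refine IsBigO.of_bound 688 (h10.mono fun N hN => ?_)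
    rw [Real.norm_eq_abs, Real.norm_of_nonneg (by positivity)]
    exact abs_prod_one_sub_sub_le (by omega)
  have hJ : (fun N : ℕ => (∫ s in
      -(2 / (Real.sqrt 3 / Real.sqrt N))..2 / (Real.sqrt 3 / Real.sqrt N),
      Real.exp (logSincRatio N (Real.sqrt 3 / Real.sqrt N * s))) / Real.sqrt (2 * Real.pi) -
      (1 + -(3 / 20) * (N : ℝ)⁻¹ + (1 / 2 - 1 / 7 + 21 / 160) * (N : ℝ)⁻¹ ^ 2)) =O[atTop]
      fun N : ℕ => (N : ℝ)⁻¹ ^ 3 := by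
    have h2pi : 0 < Real.sqrt (2 * Real.pi) := Real.sqrt_pos.2 (by positivity)
    refine IsBigO.of_bound (86 * 300 ^ 3 *
      (∫ s : ℝ, (1 + s ^ 2) ^ 12 * Real.exp (-(s ^ 2 / 2))) / Real.sqrt (2 * Real.pi))
      (h10.mono fun N hN => ?_)
    have hN0 : (0 : ℝ) < N := by exact_mod_cast (by omega : 0 < N)
    have h := abs_integral_exp_logSincRatio_sub_le hN
      (c := Real.sqrt 3 / Real.sqrt N) (by positivity) (by
        rw [div_pow, Real.sq_sqrt (by norm_num), Real.sq_sqrt hN0.le]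
        field_simp)
    rw [integral_edgeworthPoly_mul_gaussian] at h
    rw [Real.norm_eq_abs, Real.norm_of_nonneg (by positivity), div_mul_eq_mul_div,
      le_div_iff₀ h2pi, ← abs_of_pos h2pi, ← abs_mul, abs_of_pos h2pi, sub_mul,
      div_mul_cancel₀ _ h2pi.ne']
    refine (le_of_eq (by ring_nf)).trans (h.trans (le_of_eq (by ring)))
  have hR : (fun N : ℕ => Real.pi / Real.sqrt 3 * (N : ℝ) ^ 4 *
      (((N : ℝ) ^ 2 * Real.exp 1) ^ N)⁻¹ * (magicCubeSeries N : ℝ) -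
      Real.sqrt (2 * Real.pi * N) * (N / Real.exp 1) ^ N / N.factorial *
        (∏ i ∈ Finset.range N, (1 - (i : ℝ) / (N : ℝ) ^ 3)) *
        ((∫ s in -(2 / (Real.sqrt 3 / Real.sqrt N))..2 / (Real.sqrt 3 / Real.sqrt N),
          Real.exp (logSincRatio N (Real.sqrt 3 / Real.sqrt N * s))) /
            Real.sqrt (2 * Real.pi))) =O[atTop] fun N : ℕ => (N : ℝ)⁻¹ ^ 3 := by
    refine IsBigO.of_bound (Real.pi / Real.sqrt 3 * Real.exp 1 *
      ((Nat.factorial 7 : ℝ) / (1 - Real.pi / 4) ^ 7)) (h10.mono fun N hN => ?_)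
    rw [Real.norm_eq_abs, Real.norm_of_nonneg (by positivity)]
    exact abs_normalized_magicCubeSeries_sub_le hN
  refine (hR.add (expansion_mul (expansion_mul hX hA) hJ)).congr (fun N => ?_) fun N => ?_
  · rw [div_mul_eq_div_div, div_mul_eq_div_div, div_eq_mul_inv _ (N : ℝ),
      div_eq_mul_inv _ ((N : ℝ) ^ 2), ← inv_pow]
    ring
  · rw [inv_pow, one_div]
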